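/- arXiv:1004.5273 — 2 statements merged into one kernel-verified Lean document; each statement's English description precedes it below -/
import Mathlib

section
/- Let D be a connected C-homogeneous triangle-free digraph with more than one end whose underlying graph is not a tree, and let 𝒞 be a basic cut system of D. Then every 𝒞-separator S is contained in exactly two 𝒞-blocks (equivalently, S has degree two in the structure tree of D and 𝒞). -/
open Set

universe u

/-- The underlying undirected graph of a digraph given by its edge relation. -/
def UG {V : Type u} (E : V → V → Prop) : SimpleGraph V := SimpleGraph.fromRel E

/-- `E` is a digraph edge relation: irreflexive and antisymmetric. -/
def IsDigraph {V : Type u} (E : V → V → Prop) : Prop :=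
  (∀ x, ¬ E x x) ∧ ∀ x y, E x y → ¬ E y x

/-- A ray in a graph: a one-way infinite path. -/
def IsRay {V : Type u} (G : SimpleGraph V) (r : ℕ → V) : Prop :=
  Function.Injective r ∧ ∀ n, G.Adj (r n) (r (n + 1))

/-- A sequence is eventually in a set. -/
def EventuallyIn {V : Type u} (r : ℕ → V) (C : Set V) : Prop :=
  ∃ N, ∀ n, N ≤ n → r n ∈ C

/-- `C` is a connected component of the subgraph of `G` induced on `W`:
a maximal connected subset of `W`. -/
def IsCompOf {V : Type u} (G : SimpleGraph V) (C W : Set V) : Prop :=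
  C.Nonempty ∧ C ⊆ W ∧ (G.induce C).Connected ∧
    ∀ C', C ⊆ C' → C' ⊆ W → (G.induce C').Connected → C' = C

/-- Two rays are equivalent if for every finite vertex set `S` they lie eventually
in the same component of the graph minus `S`. -/
def RayEquiv {V : Type u} (G : SimpleGraph V) (r r' : ℕ → V) : Prop :=
  ∀ S : Finset V, ∃ C : Set V, IsCompOf G C {v | v ∉ S} ∧
    EventuallyIn r C ∧ EventuallyIn r' C

/-- The graph has more than one end: two inequivalent rays. -/
def MoreThanOneEnd {V : Type u} (G : SimpleGraph V) : Prop :=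
  ∃ r r' : ℕ → V, IsRay G r ∧ IsRay G r' ∧ ¬ RayEquiv G r r'

/-- The graph has infinitely many ends: arbitrarily large families of pairwise
inequivalent rays. -/
def InfinitelyManyEnds {V : Type u} (G : SimpleGraph V) : Prop :=
  ∀ n : ℕ, ∃ f : Fin n → (ℕ → V), (∀ i, IsRay G (f i)) ∧
    ∀ i j, i ≠ j → ¬ RayEquiv G (f i) (f j)

/-- A separation of a graph: a pair of vertex sets covering `V` such that every
edge lies within one side. -/
def IsSeparation {V : Type u} (G : SimpleGraph V) (c : Set V × Set V) : Prop :=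
  c.1 ∪ c.2 = univ ∧ ∀ x y, G.Adj x y → (x ∈ c.1 ∧ y ∈ c.1) ∨ (x ∈ c.2 ∧ y ∈ c.2)

/-- The order of a separation: the number of vertices in its separator. -/
noncomputable def sepOrder {V : Type u} (c : Set V × Set V) : ℕ := (c.1 ∩ c.2).ncard

/-- The neighbourhood of a vertex set. -/
def Nbhd {V : Type u} (G : SimpleGraph V) (A : Set V) : Set V :=
  {v | v ∉ A ∧ ∃ u ∈ A, G.Adj u v}

/-- The separation `(A, ∼)`. -/
def tildeSep {V : Type u} (G : SimpleGraph V) (A : Set V) : Set V × Set V :=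
  (A, Aᶜ ∪ Nbhd G Aᶜ)

/-- `S` separates the wings of the separation `c`: every walk from one wing to
the other meets `S`. -/
def SeparatesWings {V : Type u} (G : SimpleGraph V) (c : Set V × Set V) (S : Set V) : Prop :=
  ∀ a ∈ c.1 \ c.2, ∀ b ∈ c.2 \ c.1, ∀ w : G.Walk a b, ∃ v ∈ w.support, v ∈ S

/-- A separation of finite order with non-empty wings is essential if its first wing is
connected and no proper subset of the separator separates the wings. -/
def IsEssential {V : Type u} (G : SimpleGraph V) (c : Set V × Set V) : Prop :=
  IsSeparation G c ∧ (c.1 ∩ c.2).Finite ∧ (c.1 \ c.2).Nonempty ∧ (c.2 \ c.1).Nonempty ∧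
  (G.induce (c.1 \ c.2)).Connected ∧
  ∀ S, S ⊂ c.1 ∩ c.2 → ¬ SeparatesWings G c S

/-- `C` is a wing of some separation in `𝒞`. -/
def IsWingOf {V : Type u} (𝒞 : Set (Set V × Set V)) (C : Set V) : Prop :=
  ∃ d ∈ 𝒞, C = d.1 \ d.2 ∨ C = d.2 \ d.1

/-- A cut system. -/
def IsCutSystem {V : Type u} (G : SimpleGraph V) (𝒞 : Set (Set V × Set V)) : Prop :=
  𝒞.Nonempty ∧ (∀ c ∈ 𝒞, IsEssential G c) ∧
  (∀ c ∈ 𝒞, ∃ d ∈ 𝒞, d.1 ⊆ c.2) ∧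
  (∀ c ∈ 𝒞, ∀ C : Set V, IsCompOf G C (c.2 \ c.1) →
    (∃ d ∈ 𝒞, d.1 \ d.2 ⊆ C) → tildeSep G (C ∪ Nbhd G C) ∈ 𝒞) ∧
  (∀ c ∈ 𝒞, ∀ c' ∈ 𝒞, ∃ C₁ C₂ : Set V,
    ((IsCompOf G C₁ ((c.1 \ c.2) ∩ (c'.1 \ c'.2)) ∧
      IsCompOf G C₂ ((c.2 \ c.1) ∩ (c'.2 \ c'.1))) ∨
     (IsCompOf G C₁ ((c.2 \ c.1) ∩ (c'.1 \ c'.2)) ∧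
      IsCompOf G C₂ ((c.1 \ c.2) ∩ (c'.2 \ c'.1)))) ∧
    IsWingOf 𝒞 C₁ ∧ IsWingOf 𝒞 C₂)

/-- Pick a side of a separation. -/
def pickSide {V : Type u} (c : Set V × Set V) : Bool → Set V
  | false => c.1
  | true => c.2

/-- Two cuts are nested (with respect to the cut system `𝒞`). -/
def NestedPair {V : Type u} (G : SimpleGraph V) (𝒞 : Set (Set V × Set V))
    (c d : Set V × Set V) : Prop :=
  ∃ i j : Bool,
    ((¬ ∃ C, IsCompOf G C ((tildeSep G (pickSide c i ∩ pickSide d j)).1 \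
        (tildeSep G (pickSide c i ∩ pickSide d j)).2) ∧
        tildeSep G (C ∪ Nbhd G C) ∈ 𝒞) ∨
     (¬ ∃ C, IsCompOf G C ((tildeSep G (pickSide c i ∩ pickSide d j)).2 \
        (tildeSep G (pickSide c i ∩ pickSide d j)).1) ∧
        tildeSep G (C ∪ Nbhd G C) ∈ 𝒞)) ∧
    (c.1 ∩ c.2) ∪ (d.1 ∩ d.2) ⊆ pickSide c (!i) ∩ pickSide d (!j)

/-- A cut system is nested if each two of its cuts are nested. -/
def IsNestedSystem {V : Type u} (G : SimpleGraph V) (𝒞 : Set (Set V × Set V)) : Prop :=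
  ∀ c ∈ 𝒞, ∀ d ∈ 𝒞, NestedPair G 𝒞 c d

/-- `S` is a `𝒞`-separator. -/
def IsSeparatorOf {V : Type u} (𝒞 : Set (Set V × Set V)) (S : Set V) : Prop :=
  ∃ c ∈ 𝒞, c.1 ∩ c.2 = S

/-- A vertex set contains an end: some ray lies in it. -/
def ContainsEnd {V : Type u} (G : SimpleGraph V) (A : Set V) : Prop :=
  ∃ r : ℕ → V, IsRay G r ∧ ∀ n, r n ∈ A

/-- A basic cut system. -/
def IsBasic {V : Type u} (G : SimpleGraph V) (𝒞 : Set (Set V × Set V)) : Prop :=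
  IsCutSystem G 𝒞 ∧
  (∀ c ∈ 𝒞, ∀ d ∈ 𝒞, ¬ sepOrder c < sepOrder d) ∧
  IsNestedSystem G 𝒞 ∧
  (∀ φ : G ≃g G, ∀ c ∈ 𝒞, ((⇑φ '' c.1, ⇑φ '' c.2) : Set V × Set V) ∈ 𝒞) ∧
  (∀ S S' : Set V, IsSeparatorOf 𝒞 S → IsSeparatorOf 𝒞 S' → ∃ φ : G ≃g G, ⇑φ '' S = S') ∧
  (∀ c ∈ 𝒞, ContainsEnd G c.1 ∧ ContainsEnd G c.2 ∧
    ¬ ∃ d : Set V × Set V, IsSeparation G d ∧ (d.1 ∩ d.2).Finite ∧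
      (d.1 ∩ d.2).ncard < sepOrder c ∧ ContainsEnd G d.1 ∧ ContainsEnd G d.2)

/-- The defining property of a `𝒞`-block. -/
def BlockProp {V : Type u} (𝒞 : Set (Set V × Set V)) (X : Set V) : Prop :=
  (∀ c ∈ 𝒞, (X ⊆ c.1 ∨ X ⊆ c.2) ∧ ¬ (X ⊆ c.1 ∧ X ⊆ c.2)) ∧
  ∃ c ∈ 𝒞, X ⊆ c.1 ∧ c.1 ∩ c.2 ⊆ X

/-- A `𝒞`-block: a maximal vertex set with the block property. -/
def IsCBlock {V : Type u} (𝒞 : Set (Set V × Set V)) (X : Set V) : Prop :=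
  BlockProp 𝒞 X ∧ ∀ X', X ⊆ X' → BlockProp 𝒞 X' → X' = X

/-- A digraph is C-homogeneous: every isomorphism between finite induced
subdigraphs with connected underlying graphs extends to an automorphism. -/
def DigraphCHom {V : Type u} (E : V → V → Prop) : Prop :=
  ∀ (X Y : Set V), X.Finite → Y.Finite → ((UG E).induce X).Connected →
  ∀ φ : X ≃ Y, (∀ a b : X, E a.1 b.1 ↔ E (φ a).1 (φ b).1) →
  ∃ ψ : Equiv.Perm V, (∀ x y, E (ψ x) (ψ y) ↔ E x y) ∧ ∀ a : X, ψ a.1 = (φ a).1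

/-- A graph is C-homogeneous: every isomorphism between finite connected induced
subgraphs extends to an automorphism. -/
def GraphCHom {V : Type u} (G : SimpleGraph V) : Prop :=
  ∀ (X Y : Set V), X.Finite → Y.Finite → (G.induce X).Connected →
  ∀ φ : X ≃ Y, (∀ a b : X, G.Adj a.1 b.1 ↔ G.Adj (φ a).1 (φ b).1) →
  ∃ ψ : G ≃g G, ∀ a : X, ψ a.1 = (φ a).1

/-- The digraph contains a triangle: three pairwise adjacent vertices. -/
def HasTriangle {V : Type u} (E : V → V → Prop) : Prop :=
  ∃ x y z : V, (UG E).Adj x y ∧ (UG E).Adj y z ∧ (UG E).Adj x z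

/-- An `n`-arc: a directed path `p 0, p 1, …, p n`. -/
def IsArc {V : Type u} (E : V → V → Prop) (n : ℕ) (p : ℕ → V) : Prop :=
  (∀ i j, i ≤ n → j ≤ n → p i = p j → i = j) ∧ ∀ i < n, E (p i) (p (i + 1))

/-- A digraph is highly-arc-transitive: for every `n`, its automorphism group acts
transitively on `n`-arcs. -/
def HighlyArcTransitive {V : Type u} (E : V → V → Prop) : Prop :=
  ∀ n : ℕ, ∀ p q : ℕ → V, IsArc E n p → IsArc E n q →
  ∃ ψ : Equiv.Perm V, (∀ x y, E (ψ x) (ψ y) ↔ E x y) ∧ ∀ i ≤ n, ψ (p i) = q i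

/-- An alternating walk `w 0, …, w n` in a digraph. -/
def IsAltWalk {V : Type u} (E : V → V → Prop) (n : ℕ) (w : ℕ → V) : Prop :=
  (∀ i < n, E (w i) (w (i + 1)) ∨ E (w (i + 1)) (w i)) ∧
  ∀ i, i + 2 ≤ n → (E (w i) (w (i + 1)) ↔ E (w (i + 2)) (w (i + 1)))

/-- The edge `e` lies on the walk `w 0, …, w n` (in either direction). -/
def EdgeOnWalk {V : Type u} (n : ℕ) (w : ℕ → V) (e : V × V) : Prop :=
  ∃ i < n, (w i = e.1 ∧ w (i + 1) = e.2) ∨ (w i = e.2 ∧ w (i + 1) = e.1)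

/-- Two edges are reachable from each other: they lie on a common alternating walk. -/
def Reach {V : Type u} (E : V → V → Prop) (e f : V × V) : Prop :=
  ∃ n w, IsAltWalk E n w ∧ EdgeOnWalk n w e ∧ EdgeOnWalk n w f

/-- The edge relation of the reachability digraph `Δ_e`. -/
def DeltaRel {V : Type u} (E : V → V → Prop) (e : V × V) : V → V → Prop :=
  fun x y => E x y ∧ Reach E e (x, y)

/-- The underlying undirected graph of the reachability digraph `Δ_e`. -/
def DeltaGraph {V : Type u} (E : V → V → Prop) (e : V × V) : SimpleGraph V :=
  UG (DeltaRel E e)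

/-- Tails of edges of `𝒜(e)`. -/
def Tails {V : Type u} (E : V → V → Prop) (e : V × V) : Set V :=
  {x | ∃ y, DeltaRel E e x y}

/-- Heads of edges of `𝒜(e)`. -/
def Heads {V : Type u} (E : V → V → Prop) (e : V × V) : Set V :=
  {y | ∃ x, DeltaRel E e x y}

/-- The set of descendants of a vertex. -/
def Descendants {V : Type u} (E : V → V → Prop) (x : V) : Set V :=
  {y | ∃ n p, IsArc E n p ∧ p 0 = x ∧ p n = y}

/-- `(X, Y)` is a bipartition of the graph `G`. -/
def IsBipartition {V : Type u} (G : SimpleGraph V) (X Y : Set V) : Prop :=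
  X ∪ Y = univ ∧ Disjoint X Y ∧
  ∀ a b, G.Adj a b → (a ∈ X ∧ b ∈ Y) ∨ (a ∈ Y ∧ b ∈ X)

/-- `G` with sides `X`, `Y` is C-homogeneous bipartite: every isomorphism between
finite connected induced subgraphs preserving the sides extends to a side-preserving
automorphism. -/
def BipCHom {V : Type u} (G : SimpleGraph V) (X Y : Set V) : Prop :=
  ∀ (A B : Set V), A.Finite → B.Finite → (G.induce A).Connected →
  ∀ φ : A ≃ B, (∀ a b : A, G.Adj a.1 b.1 ↔ G.Adj (φ a).1 (φ b).1) →
  (∀ a : A, a.1 ∈ X ↔ (φ a).1 ∈ X) → (∀ a : A, a.1 ∈ Y ↔ (φ a).1 ∈ Y) →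
  ∃ ψ : G ≃g G, (∀ v, v ∈ X ↔ ψ v ∈ X) ∧ (∀ v, v ∈ Y ↔ ψ v ∈ Y) ∧
    ∀ a : A, ψ a.1 = (φ a).1

/-- `G` with sides `X`, `Y` is homogeneous bipartite: every isomorphism between
finite induced subgraphs preserving the sides extends to a side-preserving
automorphism. -/
def BipHom {V : Type u} (G : SimpleGraph V) (X Y : Set V) : Prop :=
  ∀ (A B : Set V), A.Finite → B.Finite →
  ∀ φ : A ≃ B, (∀ a b : A, G.Adj a.1 b.1 ↔ G.Adj (φ a).1 (φ b).1) →
  (∀ a : A, a.1 ∈ X ↔ (φ a).1 ∈ X) → (∀ a : A, a.1 ∈ Y ↔ (φ a).1 ∈ Y) →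
  ∃ ψ : G ≃g G, (∀ v, v ∈ X ↔ ψ v ∈ X) ∧ (∀ v, v ∈ Y ↔ ψ v ∈ Y) ∧
    ∀ a : A, ψ a.1 = (φ a).1

/-- `G` with sides `X`, `Y` is generic bipartite. -/
def GenericBip {V : Type u} (G : SimpleGraph V) (X Y : Set V) : Prop :=
  (∀ U W : Set V, U ⊆ X → W ⊆ X → U.Finite → W.Finite → Disjoint U W →
    ∃ v ∈ Y, (∀ u ∈ U, G.Adj v u) ∧ ∀ w ∈ W, ¬ G.Adj v w) ∧
  (∀ U W : Set V, U ⊆ Y → W ⊆ Y → U.Finite → W.Finite → Disjoint U W →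
    ∃ v ∈ X, (∀ u ∈ U, G.Adj v u) ∧ ∀ w ∈ W, ¬ G.Adj v w)

namespace CutSystem

variable {V : Type u} {G : SimpleGraph V}

/-- Connectedness of the nonempty set `X` in `G`, phrased by closure under adjacency. -/
def ConnectedSet (G : SimpleGraph V) (X : Set V) : Prop :=
  X.Nonempty ∧ ∀ P : Set V, (∃ a ∈ X, a ∈ P) →
    (∀ x ∈ X, x ∈ P → ∀ z ∈ X, G.Adj x z → z ∈ P) → X ⊆ P

lemma connectedSet_iff {X : Set V} : (G.induce X).Connected ↔ ConnectedSet G X := by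
  constructor
  · intro h
    refine ⟨Set.nonempty_coe_sort.1 h.nonempty, ?_⟩
    rintro P ⟨a, ha, haP⟩ hP b hb
    obtain ⟨w⟩ := h.preconnected ⟨a, ha⟩ ⟨b, hb⟩
    have key : ∀ (p q : X) (_ : (G.induce X).Walk p q), p.1 ∈ P → q.1 ∈ P := by
      intro p q w
      induction w with
      | nil => exact id
      | cons hadj _ ih => exact fun hp => ih (hP _ (Subtype.prop _) hp _ (Subtype.prop _) hadj)
    exact key _ _ w haP
  · rintro ⟨⟨a, ha⟩, h⟩
    have hr : ∀ b (hb : b ∈ X), (G.induce X).Reachable ⟨a, ha⟩ ⟨b, hb⟩ := by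
      have := h {b | ∃ hb : b ∈ X, (G.induce X).Reachable ⟨a, ha⟩ ⟨b, hb⟩}
        ⟨a, ha, ha, SimpleGraph.Reachable.refl _⟩ ?_
      · intro b hb
        exact (this hb).2
      · rintro x hx ⟨_, hr⟩ z hz hxz
        exact ⟨hz, hr.trans (SimpleGraph.Adj.reachable (by simpa using hxz))⟩
    have : Nonempty X := ⟨⟨a, ha⟩⟩
    exact ⟨fun p q => (hr p.1 p.2).symm.trans (hr q.1 q.2)⟩

lemma connectedSet_singleton (a : V) : ConnectedSet G {a} := by
  refine ⟨⟨a, rfl⟩, ?_⟩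
  rintro P ⟨b, rfl, hb⟩ _ c rfl
  exact hb

lemma ConnectedSet.insert_adj {X : Set V} (h : ConnectedSet G X) {x z : V} (hx : x ∈ X)
    (hxz : G.Adj x z) : ConnectedSet G (insert z X) := by
  refine ⟨⟨z, by simp⟩, ?_⟩
  rintro P ⟨a, ha, haP⟩ hP
  have hex : ∃ b ∈ X, b ∈ P := by
    rcases ha with rfl | ha
    · exact ⟨x, hx, hP a (by simp) haP x (by simp [hx]) hxz.symm⟩
    · exact ⟨a, ha, haP⟩
  have hX : X ⊆ P := h.2 P hex fun p hp hpP q hq hpq =>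
    hP p (Set.mem_insert_of_mem _ hp) hpP q (Set.mem_insert_of_mem _ hq) hpq
  exact Set.insert_subset (hP x (by simp [hx]) (hX hx) z (by simp) hxz) hX

lemma ConnectedSet.union {X Y : Set V} (hX : ConnectedSet G X) (hY : ConnectedSet G Y) {a : V}
    (haX : a ∈ X) (haY : a ∈ Y) : ConnectedSet G (X ∪ Y) := by
  refine ⟨⟨a, Or.inl haX⟩, ?_⟩
  rintro P ⟨b, hb, hbP⟩ hP
  have h1 : (∃ c ∈ X, c ∈ P) → X ⊆ P := fun h => hX.2 P h fun p hp hpP q hq =>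
    hP p (Or.inl hp) hpP q (Or.inl hq)
  have h2 : (∃ c ∈ Y, c ∈ P) → Y ⊆ P := fun h => hY.2 P h fun p hp hpP q hq =>
    hP p (Or.inr hp) hpP q (Or.inr hq)
  rcases hb with hb | hb
  · have := h1 ⟨b, hb, hbP⟩
    exact Set.union_subset this (h2 ⟨a, haY, this haX⟩)
  · have := h2 ⟨b, hb, hbP⟩
    exact Set.union_subset (h1 ⟨a, haX, this haY⟩) this

lemma ConnectedSet.exists_finite_pair {X : Set V} (h : ConnectedSet G X) {p q : V} (hp : p ∈ X)
    (hq : q ∈ X) : ∃ R ⊆ X, R.Finite ∧ ConnectedSet G R ∧ p ∈ R ∧ q ∈ R := by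
  refine h.2 {q | ∃ R ⊆ X, R.Finite ∧ ConnectedSet G R ∧ p ∈ R ∧ q ∈ R}
    ⟨p, hp, {p}, by simpa, by simp, connectedSet_singleton p, rfl, rfl⟩ ?_ hq
  rintro x hx ⟨R, hRX, hRf, hR, hpR, hxR⟩ z hz hxz
  exact ⟨insert z R, Set.insert_subset hz hRX, hRf.insert z, hR.insert_adj hxR hxz,
    Or.inr hpR, Or.inl rfl⟩

lemma ConnectedSet.exists_finite_triple {X : Set V} (h : ConnectedSet G X) {p q r : V}
    (hp : p ∈ X) (hq : q ∈ X) (hr : r ∈ X) :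
    ∃ R ⊆ X, R.Finite ∧ ConnectedSet G R ∧ p ∈ R ∧ q ∈ R ∧ r ∈ R := by
  obtain ⟨R, hRX, hRf, hR, hpR, hqR⟩ := h.exists_finite_pair hp hq
  obtain ⟨T, hTX, hTf, hT, hpT, hrT⟩ := h.exists_finite_pair hp hr
  exact ⟨R ∪ T, Set.union_subset hRX hTX, hRf.union hTf, hR.union hT hpR hpT,
    Or.inl hpR, Or.inl hqR, Or.inr hrT⟩

lemma mem_or_mem_nbhd {C : Set V} {a b : V} (ha : a ∈ C) (hab : G.Adj a b) :
    b ∈ C ∨ b ∈ Nbhd G C := by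
  by_cases hb : b ∈ C
  · exact Or.inl hb
  · exact Or.inr ⟨hb, a, ha, hab⟩

/-- A connected set avoiding the neighbourhood of `C` and meeting `C` lies in `C`. -/
lemma ConnectedSet.subset_of_disjoint {C D : Set V} (hD : ConnectedSet G D)
    (hdis : Disjoint D (Nbhd G C)) {d : V} (hd : d ∈ D) (hdC : d ∈ C) : D ⊆ C :=
  hD.2 C ⟨d, hd, hdC⟩ fun _ _ hxC _ hz hxz =>
    (mem_or_mem_nbhd hxC hxz).resolve_right fun h => Set.disjoint_left.1 hdis hz h

lemma nbhd_image (ψ : G ≃g G) (C : Set V) : Nbhd G (ψ '' C) = ψ '' Nbhd G C := by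
  ext v
  obtain ⟨v, rfl⟩ := ψ.surjective v
  simp [Nbhd, SimpleGraph.Iso.map_adj_iff, ψ.injective.eq_iff]
  intros
  exact ⟨fun h hv => h v hv rfl, fun h x hx hxv => h (hxv ▸ hx)⟩

/-- The vertices reachable from `v` by walks that avoid `S` after their first vertex. -/
def Avoids (G : SimpleGraph V) (S : Set V) (v w : V) : Prop :=
  Relation.ReflTransGen (fun a b => G.Adj a b ∧ b ∉ S) v w

lemma Avoids.mono {S T : Set V} (hST : S ⊆ T) {v w : V} (h : Avoids G T v w) : Avoids G S v w :=
  Relation.ReflTransGen.mono (fun _ _ h => ⟨h.1, fun hs => h.2 (hST hs)⟩) _ _ h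

lemma Avoids.notMem {S : Set V} {v w : V} (hv : v ∉ S) (h : Avoids G S v w) : w ∉ S := by
  induction h with
  | refl => exact hv
  | tail _ h _ => exact h.2

lemma ConnectedSet.avoids {S X : Set V} (hX : ConnectedSet G X) (hd : Disjoint X S) {v w : V}
    (hv : v ∈ X) (hw : w ∈ X) : Avoids G S v w :=
  hX.2 {w | Avoids G S v w} ⟨v, hv, .refl⟩
    (fun _ _ h _ hz hxz => .tail h ⟨hxz, fun hs => Set.disjoint_left.1 hd hz hs⟩) hw

lemma connectedSet_avoids (S : Set V) (v : V) : ConnectedSet G {w | Avoids G S v w} := by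
  refine ⟨⟨v, .refl⟩, ?_⟩
  have symm' : ∀ P : Set V, (∀ x ∈ {w | Avoids G S v w}, x ∈ P → ∀ z ∈ {w | Avoids G S v w},
      G.Adj x z → z ∈ P) → ∀ w, Avoids G S v w → (w ∈ P ↔ v ∈ P) := by
    intro P hP w hw
    induction hw with
    | refl => exact Iff.rfl
    | tail h1 h2 ih =>
      rw [← ih]
      exact ⟨fun h => hP _ (.tail h1 h2) h _ h1 h2.1.symm, fun h => hP _ h1 h _ (.tail h1 h2) h2.1⟩
  rintro P ⟨a, ha, haP⟩ hP w hw
  rw [symm' P hP w hw, ← symm' P hP a ha]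
  exact haP

/-- The set `S` minimally separates `x` from `y` in `G - Z`. -/
def MinSep (G : SimpleGraph V) (Z : Set V) (x y : V) (S : Set V) : Prop :=
  ¬ Avoids G (Z ∪ S) x y ∧ ∀ s ∈ S, Avoids G (Z ∪ (S \ {s})) x y

lemma Avoids.exists_finite {Z : Set V} {x y : V} (h : Avoids G Z x y) :
    ∃ P : Set V, P.Finite ∧ ∀ S, Disjoint P S → Avoids G (Z ∪ S) x y := by
  induction h with
  | refl => exact ⟨∅, by simp, fun _ _ => .refl⟩
  | @tail b c _ h ih =>
    obtain ⟨P, hP, hPS⟩ := ih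
    refine ⟨insert c P, hP.insert c, fun S hS => .tail (hPS S ?_) ⟨h.1, ?_⟩⟩
    · exact hS.mono_left (Set.subset_insert _ _)
    · rintro (hc | hc)
      · exact h.2 hc
      · exact Set.disjoint_left.1 hS (Set.mem_insert _ _) hc

lemma finite_minSep (k : ℕ) (Z : Set V) (x y : V) :
    {S : Set V | S.Finite ∧ S.ncard = k ∧ MinSep G Z x y S}.Finite := by
  induction k generalizing Z with
  | zero =>
    refine (Set.finite_singleton (∅ : Set V)).subset ?_
    rintro S ⟨hf, hc, -⟩
    exact (Set.ncard_eq_zero hf).1 hc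
  | succ k ih =>
    by_cases hxy : Avoids G Z x y
    · obtain ⟨P, hP, hPS⟩ := hxy.exists_finite
      refine (hP.biUnion fun z _ => (ih (Z ∪ {z})).image (insert z)).subset ?_
      rintro S ⟨hf, hc, hS⟩
      obtain ⟨z, hzP, hzS⟩ := Set.not_disjoint_iff.1 fun h => hS.1 (hPS S h)
      refine Set.mem_biUnion hzP ⟨S \ {z}, ⟨hf.subset Set.sdiff_subset, ?_, ?_, ?_⟩, ?_⟩
      · have := Set.ncard_sdiff_singleton_add_one hzS hf
        omega
      · rw [show Z ∪ {z} ∪ S \ {z} = Z ∪ S by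
          ext v; by_cases hv : v = z <;> simp [hv, hzS]]
        exact hS.1
      · rintro s ⟨hs, hsz⟩
        rw [show Z ∪ {z} ∪ (S \ {z}) \ {s} = Z ∪ S \ {s} by
          ext v
          by_cases hv : v = z
          · subst hv; simp [hzS, Ne.symm (show s ≠ v from hsz)]
          · simp [hv]]
        exact hS.2 s hs
      · simp [Set.insert_eq_of_mem hzS]
    · refine Set.Finite.subset Set.finite_empty ?_
      rintro S ⟨hf, hc, hS⟩
      obtain ⟨s, hs⟩ := Set.nonempty_of_ncard_ne_zero (s := S) (by omega)
      exact hxy ((hS.2 s hs).mono Set.subset_union_left)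

/-- The properties of the wings `C = A ∖ B` of the cuts `(A, B)` of a basic cut system that are
used below. The separator of such a cut is the neighbourhood of `C`. -/
structure WingSystem (G : SimpleGraph V) (Wg : Set V → Prop) : Prop where
  univ : ConnectedSet G Set.univ
  conn : ∀ {C}, Wg C → ConnectedSet G C
  fin : ∀ {C}, Wg C → (Nbhd G C).Finite
  card : ∀ {C D}, Wg C → Wg D → (Nbhd G C).ncard = (Nbhd G D).ncard
  other : ∀ {C}, Wg C → ∃ D, Wg D ∧ D ≠ C ∧ Nbhd G D = Nbhd G C
  ext : ∀ {C D}, Wg C → Wg D → Disjoint D (Nbhd G C) →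
    ∃ K, Wg K ∧ Nbhd G K = Nbhd G C ∧ D ⊆ K
  nest : ∀ {C D}, Wg C → Wg D → Nbhd G D ⊆ C ∪ Nbhd G C ∨ Disjoint (Nbhd G D) C
  aut : ∀ (ψ : G ≃g G) {C}, Wg C → Wg (ψ '' C)
  trans : ∀ {C D}, Wg C → Wg D → ∃ ψ : G ≃g G, ψ '' Nbhd G C = Nbhd G D
  thin : ∀ {C c y t}, Wg C → c ∈ C → y ∈ Nbhd G C → t ∈ Nbhd G C → y ≠ t →
    (∀ b ∈ C, G.Adj y b → b = c) → (∀ b ∈ C, G.Adj t b → b = c) → False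

lemma disjoint_nbhd (C : Set V) : Disjoint C (Nbhd G C) :=
  Set.disjoint_left.2 fun _ h h' => h'.1 h

lemma mem_of_adj {K : Set V} {a b : V} (ha : a ∈ K) (hab : G.Adj a b) (hb : b ∉ Nbhd G K) :
    b ∈ K :=
  (mem_or_mem_nbhd ha hab).resolve_right hb

lemma exists_adj_of_mem_nbhd {C : Set V} {s : V} (hs : s ∈ Nbhd G C) : ∃ a ∈ C, G.Adj s a :=
  let ⟨a, ha, h⟩ := hs.2
  ⟨a, ha, h.symm⟩

lemma image_inv_image (ψ : G ≃g G) (C : Set V) : ψ.symm '' (ψ '' C) = C := by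
  rw [Set.image_image]; simp

namespace WingSystem

variable {Wg : Set V → Prop} (h : WingSystem G Wg) {A B C D K : Set V}

include h

lemma eq_of_mem (hC : Wg C) (hD : Wg D) (hN : Nbhd G C = Nbhd G D) {a : V} (haC : a ∈ C)
    (haD : a ∈ D) : C = D := by
  apply Set.Subset.antisymm
  · exact (h.conn hC).subset_of_disjoint (hN ▸ disjoint_nbhd C) haC haD
  · exact (h.conn hD).subset_of_disjoint (hN ▸ disjoint_nbhd D) haD haC

lemma disjoint_of_ne (hC : Wg C) (hD : Wg D) (hN : Nbhd G C = Nbhd G D) (hne : C ≠ D) :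
    Disjoint C D :=
  Set.disjoint_left.2 fun _ haC haD => hne (h.eq_of_mem hC hD hN haC haD)

lemma nbhd_nonempty (hC : Wg C) : (Nbhd G C).Nonempty := by
  by_contra hne
  rw [Set.not_nonempty_iff_eq_empty] at hne
  obtain ⟨D, hD, hDC, hN⟩ := h.other hC
  obtain ⟨a, ha⟩ := (h.conn hC).1
  obtain ⟨d, hd⟩ := (h.conn hD).1
  have := h.univ.subset_of_disjoint (C := C) (by simp [hne]) (Set.mem_univ a) ha
  exact hDC (h.eq_of_mem hD hC hN hd (this (Set.mem_univ d)))

/-- If the separator of `A` lies on the side of `B` and meets `A`, the wings opposite to `B`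
lie in `A`. -/
lemma opposite_subset (hB : Wg B) {x : V} (hxB : x ∈ Nbhd G B) (hxA : x ∈ A)
    (hAB : Nbhd G A ⊆ B ∪ Nbhd G B) (hD : Wg D) (hN : Nbhd G D = Nbhd G B) (hDB : D ≠ B) :
    D ⊆ A := by
  have hdis : Disjoint D (Nbhd G A) := by
    refine Disjoint.mono_right hAB (Set.disjoint_union_right.2 ⟨?_, ?_⟩)
    · exact h.disjoint_of_ne hD hB hN hDB
    · exact hN ▸ disjoint_nbhd D
  obtain ⟨d, hd, hxd⟩ := exists_adj_of_mem_nbhd (hN ▸ hxB : x ∈ Nbhd G D)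
  exact (h.conn hD).subset_of_disjoint hdis hd
    (mem_of_adj hxA hxd (Set.disjoint_left.1 hdis hd))

/-- If the separator of `D` lies on the side of `C`, then a wing `B` opposite to `C` extends to a
wing of the separator of `D`. -/
lemma exists_extension (hC : Wg C) (hB : Wg B) (hN : Nbhd G B = Nbhd G C) (hBC : B ≠ C)
    (hD : Wg D) (hDC : Nbhd G D ⊆ C ∪ Nbhd G C) :
    ∃ K, Wg K ∧ Nbhd G K = Nbhd G D ∧ B ⊆ K ∧ ∀ s ∈ Nbhd G C, s ∉ Nbhd G D → s ∈ K := by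
  obtain ⟨K, hK, hKN, hBK⟩ := h.ext hD hB
    (Disjoint.mono_right hDC (Set.disjoint_union_right.2
      ⟨h.disjoint_of_ne hB hC hN hBC, hN ▸ disjoint_nbhd B⟩))
  refine ⟨K, hK, hKN, hBK, fun s hs hsD => ?_⟩
  obtain ⟨b, hb, hsb⟩ := exists_adj_of_mem_nbhd (hN ▸ hs : s ∈ Nbhd G B)
  exact mem_of_adj (hBK hb) hsb.symm (hKN ▸ hsD)

lemma nbhd_eq_of_subset (hC : Wg C) (hD : Wg D) (hs : Nbhd G C ⊆ Nbhd G D) :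
    Nbhd G C = Nbhd G D :=
  Set.eq_of_subset_of_ncard_le hs (h.card hD hC).le (h.fin hD)

end WingSystem

/-- `C` is the wing `A ∖ B` of some cut `(A, B)` in `𝒞`. -/
def IsLeftWing (𝒞 : Set (Set V × Set V)) (C : Set V) : Prop := ∃ c ∈ 𝒞, c.1 \ c.2 = C

section IsEssential

variable {c : Set V × Set V}

lemma nbhd_leftWing (hc : IsEssential G c) : Nbhd G (c.1 \ c.2) = c.1 ∩ c.2 := by
  obtain ⟨⟨hun, hsep⟩, -, -, -, -, hmin⟩ := hc
  have hsub : Nbhd G (c.1 \ c.2) ⊆ c.1 ∩ c.2 := by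
    rintro v ⟨hv, u, hu, huv⟩
    have hv1 : v ∈ c.1 := by
      rcases hsep u v huv with h | h
      · exact h.2
      · exact absurd h.1 hu.2
    exact ⟨hv1, by_contra fun h => hv ⟨hv1, h⟩⟩
  refine hsub.antisymm fun s hs => ⟨fun h => h.2 hs.2, ?_⟩
  by_contra hno
  push Not at hno
  refine hmin ((c.1 ∩ c.2) \ {s}) ⟨Set.sdiff_subset, fun h => (h hs).2 rfl⟩ fun a ha b hb w => ?_
  by_contra hw
  push Not at hw
  have key : ∀ (a b : V) (w : G.Walk a b), (∀ v ∈ w.support, v ∉ (c.1 ∩ c.2) \ {s}) →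
      a ∈ c.1 \ c.2 → b ∈ c.1 \ c.2 := by
    intro a b w
    induction w with
    | nil => exact fun _ h => h
    | @cons a x b hax w ih =>
      intro hw ha
      refine ih (fun v hv => hw v (by simp [hv])) ?_
      refine mem_of_adj ha hax fun hx => ?_
      by_cases hxs : x = s
      · exact hno a ha (hxs ▸ hax)
      · exact hw x (by simp) ⟨hsub hx, hxs⟩
  exact hb.2 (key a b w hw ha).1

lemma fst_eq (hc : IsEssential G c) : c.1 = c.1 \ c.2 ∪ Nbhd G (c.1 \ c.2) := by
  rw [nbhd_leftWing hc, Set.sdiff_union_inter]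

lemma snd_eq (hc : IsEssential G c) : c.2 = (c.1 \ c.2)ᶜ := by
  have := hc.1.1
  ext v
  have := Set.ext_iff.1 this v
  simp at this ⊢
  tauto

lemma snd_sdiff_fst (hc : IsEssential G c) :
    c.2 \ c.1 = (c.1 \ c.2 ∪ Nbhd G (c.1 \ c.2))ᶜ := by
  conv_lhs => rw [fst_eq hc, snd_eq hc]
  ext v
  simp

end IsEssential

section CutSystems

variable {𝒞 : Set (Set V × Set V)}

lemma exists_leftWing_superset (h : IsCutSystem G 𝒞) {c : Set V × Set V} (hc : c ∈ 𝒞) {D : Set V}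
    (hD : IsLeftWing 𝒞 D) (hDc : D ⊆ c.2 \ c.1) :
    ∃ K, IsLeftWing 𝒞 K ∧ D ⊆ K ∧ Disjoint K (c.1 \ c.2) ∧ Nbhd G K ⊆ c.1 ∩ c.2 := by
  obtain ⟨-, hess, -, hcomp, -⟩ := h
  have hN := nbhd_leftWing (hess c hc)
  obtain ⟨d, hd, rfl⟩ := hD
  have hdconn := connectedSet_iff.1 (hess d hd).2.2.2.2.1
  obtain ⟨v, hv⟩ := hdconn.1
  set K : Set V := {w | Avoids G (c.1 ∩ c.2) v w} with hK
  have hKconn : ConnectedSet G K := connectedSet_avoids _ _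
  have hvS : v ∉ c.1 ∩ c.2 := fun h => (hDc hv).2 h.1
  have hKS : Disjoint K (c.1 ∩ c.2) := Set.disjoint_left.2 fun w hw => hw.notMem hvS
  have hvK : v ∈ K := Relation.ReflTransGen.refl
  have hKC : Disjoint K (c.1 \ c.2) := Set.disjoint_left.2 fun w hw hwC =>
    (hDc hv).2 (hKconn.subset_of_disjoint (hN ▸ hKS) hw hwC hvK).1
  have hKc : K ⊆ c.2 \ c.1 := by
    rw [snd_sdiff_fst (hess c hc), hN]
    rintro w hw (h | h)
    · exact Set.disjoint_left.1 hKC hw h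
    · exact Set.disjoint_left.1 hKS hw h
  have hcS : Disjoint (c.2 \ c.1) (c.1 ∩ c.2) := Set.disjoint_left.2 fun w hw h => hw.2 h.1
  have hmax : ∀ C' : Set V, v ∈ C' → C' ⊆ c.2 \ c.1 → ConnectedSet G C' → C' ⊆ K :=
    fun C' hvC' hC' hconn w hw => hconn.avoids (hcS.mono_left hC') hvC' hw
  have hNK : Nbhd G K ⊆ c.1 ∩ c.2 := by
    rintro w ⟨hwK, u, hu, huw⟩
    by_contra hw
    exact hwK (hu.tail ⟨huw, hw⟩)
  have hdK := hmax _ hv hDc hdconn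
  refine ⟨K, ⟨_, hcomp c hc K ⟨⟨v, hvK⟩, hKc, connectedSet_iff.2 hKconn, ?_⟩ ⟨d, hd, hdK⟩, ?_⟩,
    hdK, hKC, hNK⟩
  · intro C' hKC' hC' hconn
    exact (hmax C' (hKC' hvK) hC' (connectedSet_iff.1 hconn)).antisymm hKC'
  · ext w
    constructor
    · rintro ⟨hw | hw, hw'⟩
      · exact hw
      · refine absurd ?_ hw'
        obtain ⟨a, ha, hwa⟩ := exists_adj_of_mem_nbhd (hN ▸ hNK hw)
        refine Or.inr ⟨fun h => h (Or.inr hw), a, ?_, hwa.symm⟩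
        rintro (h | h)
        · exact Set.disjoint_left.1 hKC h ha
        · exact ha.2 (hNK h).2
    · refine fun hw => ⟨Or.inl hw, ?_⟩
      rintro (h | ⟨-, u, hu, huw⟩)
      · exact h (Or.inl hw)
      · exact hu (mem_or_mem_nbhd hw huw.symm)

lemma isSeparation_thin {c : Set V × Set V} (hc : IsEssential G c) {x y t : V}
    (hyC : y ∉ c.1 \ c.2) (htC : t ∉ c.1 \ c.2)
    (hy : ∀ b ∈ c.1 \ c.2, G.Adj y b → b = x) (ht : ∀ b ∈ c.1 \ c.2, G.Adj t b → b = x) :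
    IsSeparation G (c.1 \ {y, t}, insert x c.2) := by
  have side : ∀ a b, G.Adj a b → a ∈ c.1 \ c.2 → a ≠ x →
      a ∈ c.1 \ {y, t} ∧ b ∈ c.1 \ {y, t} := by
    intro a b hab ha hax
    refine ⟨⟨ha.1, ?_⟩, ?_, ?_⟩
    · rintro (rfl | rfl)
      · exact hyC ha
      · exact htC ha
    · rcases hc.1.2 a b hab with h | h
      · exact h.2
      · exact absurd h.1 ha.2
    · rintro (rfl | rfl)
      · exact hax (hy a ha hab.symm)
      · exact hax (ht a ha hab.symm)
  have hsnd : ∀ a, ¬ (a ∈ c.1 \ c.2 ∧ a ≠ x) → a ∈ insert x c.2 := by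
    intro a ha
    rw [snd_eq hc]
    by_cases hax : a = x
    · exact Or.inl hax
    · exact Or.inr fun h => ha ⟨h, hax⟩
  refine ⟨Set.eq_univ_of_forall fun v => ?_, fun a b hab => ?_⟩
  · by_cases hv : v ∈ c.1 \ c.2 ∧ v ≠ x
    · refine Or.inl ⟨hv.1.1, ?_⟩
      rintro (rfl | rfl)
      · exact hyC hv.1
      · exact htC hv.1
    · exact Or.inr (hsnd v hv)
  · by_cases ha : a ∈ c.1 \ c.2 ∧ a ≠ x
    · exact Or.inl (side a b hab ha.1 ha.2)
    by_cases hb : b ∈ c.1 \ c.2 ∧ b ≠ x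
    · exact Or.inl (side b a hab.symm hb.1 hb.2).symm
    · exact Or.inr ⟨hsnd a ha, hsnd b hb⟩

lemma containsEnd_sdiff_finite {A F : Set V} (hA : ContainsEnd G A) (hF : F.Finite) :
    ContainsEnd G (A \ F) := by
  obtain ⟨r, ⟨hinj, hadj⟩, hr⟩ := hA
  obtain ⟨n, hn⟩ := ((hF.preimage (f := r) hinj.injOn).bddAbove)
  refine ⟨fun k => r (n + 1 + k), ⟨fun a b hab => by have := hinj hab; omega, fun k => hadj _⟩,
    fun k => ⟨hr _, fun hk => ?_⟩⟩
  have := hn (show n + 1 + k ∈ r ⁻¹' F from hk)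
  omega

theorem wingSystem (hG : G.Connected) (h : IsBasic G 𝒞) : WingSystem G (IsLeftWing 𝒞) := by
  obtain ⟨hcs, hmin, hnest, haut, htrans, hends⟩ := h
  have hess := hcs.2.1
  have hcard : ∀ {C D}, IsLeftWing 𝒞 C → IsLeftWing 𝒞 D →
      (Nbhd G C).ncard = (Nbhd G D).ncard := by
    rintro _ _ ⟨c, hc, rfl⟩ ⟨d, hd, rfl⟩
    rw [nbhd_leftWing (hess c hc), nbhd_leftWing (hess d hd)]
    exact le_antisymm (not_lt.1 (hmin d hd c hc)) (not_lt.1 (hmin c hc d hd))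
  have hfin : ∀ {C}, IsLeftWing 𝒞 C → (Nbhd G C).Finite := by
    rintro _ ⟨c, hc, rfl⟩
    rw [nbhd_leftWing (hess c hc)]
    exact (hess c hc).2.1
  have hconn : ∀ {C}, IsLeftWing 𝒞 C → ConnectedSet G C := by
    rintro _ ⟨c, hc, rfl⟩
    exact connectedSet_iff.1 (hess c hc).2.2.2.2.1
  have hsup : ∀ c ∈ 𝒞, ∀ D, IsLeftWing 𝒞 D → D ⊆ c.2 \ c.1 →
      ∃ K, IsLeftWing 𝒞 K ∧ D ⊆ K ∧ Disjoint K (c.1 \ c.2) ∧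
        Nbhd G K = Nbhd G (c.1 \ c.2) := by
    intro c hc D hD hDc
    obtain ⟨K, hK, hDK, hKC, hN⟩ := exists_leftWing_superset hcs hc hD hDc
    refine ⟨K, hK, hDK, hKC, Set.eq_of_subset_of_ncard_le ?_ (hcard ⟨c, hc, rfl⟩ hK).le
      (hfin ⟨c, hc, rfl⟩)⟩
    rwa [nbhd_leftWing (hess c hc)]
  refine ⟨?_, hconn, hfin, hcard, ?_, ?_, ?_, ?_, ?_, ?_⟩
  · refine connectedSet_iff.1 ?_
    exact (SimpleGraph.induceUnivIso G).connected_iff.2 hG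
  · rintro _ ⟨c, hc, rfl⟩
    obtain ⟨d, hd, hdc⟩ := hcs.2.2.1 c hc
    have hsub : d.1 \ d.2 ⊆ c.2 \ c.1 := by
      intro s hs
      refine ⟨hdc hs.1, fun hs1 => ?_⟩
      have : s ∈ Nbhd G (c.1 \ c.2) := by
        rw [nbhd_leftWing (hess c hc)]; exact ⟨hs1, hdc hs.1⟩
      obtain ⟨a, ha, hsa⟩ := exists_adj_of_mem_nbhd this
      refine ha.2 (hdc ?_)
      rw [fst_eq (hess d hd)]
      exact mem_or_mem_nbhd hs hsa
    obtain ⟨K, hK, -, hKC, hN⟩ := hsup c hc _ ⟨d, hd, rfl⟩ hsub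
    refine ⟨K, hK, fun he => ?_, hN⟩
    obtain ⟨a, ha⟩ := (hconn hK).1
    exact Set.disjoint_left.1 hKC ha (he ▸ ha)
  · rintro _ D ⟨c, hc, rfl⟩ hD hdis
    by_cases hex : ∃ a ∈ D, a ∈ c.1 \ c.2
    · obtain ⟨a, haD, haC⟩ := hex
      exact ⟨_, ⟨c, hc, rfl⟩, rfl, (hconn hD).subset_of_disjoint hdis haD haC⟩
    · push Not at hex
      obtain ⟨K, hK, hDK, -, hN⟩ := hsup c hc D hD (by
        rw [snd_sdiff_fst (hess c hc)]
        rintro a ha (h | h)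
        · exact hex a ha h
        · exact Set.disjoint_left.1 hdis ha h)
      exact ⟨K, hK, hN, hDK⟩
  · rintro _ _ ⟨c, hc, rfl⟩ ⟨d, hd, rfl⟩
    rw [nbhd_leftWing (hess d hd)]
    obtain ⟨i, j, -, hsub⟩ := hnest c hc d hd
    have hsub' : d.1 ∩ d.2 ⊆ pickSide c (!i) := fun x hx => (hsub (Or.inr hx)).1
    cases i with
    | false =>
      refine Or.inr (Set.disjoint_left.2 fun x hx hx' => ?_)
      exact hx'.2 (hsub' hx)
    | true =>
      refine Or.inl ?_
      rw [← fst_eq (hess c hc)]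
      exact hsub'
  · rintro ψ _ ⟨c, hc, rfl⟩
    exact ⟨_, haut ψ c hc, (Set.image_sdiff ψ.injective _ _).symm⟩
  · rintro _ _ ⟨c, hc, rfl⟩ ⟨d, hd, rfl⟩
    rw [nbhd_leftWing (hess c hc), nbhd_leftWing (hess d hd)]
    exact htrans _ _ ⟨c, hc, rfl⟩ ⟨d, hd, rfl⟩
  · rintro _ x y t ⟨c, hc, rfl⟩ hxC hyN htN hyt hy ht
    obtain ⟨he1, he2, hno⟩ := hends c hc
    have hS := nbhd_leftWing (hess c hc)
    have hint : (c.1 \ {y, t}) ∩ insert x c.2 = insert x ((c.1 ∩ c.2) \ {y, t}) := by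
      ext v
      by_cases hv : v = x
      · subst hv
        simp only [Set.mem_inter_iff, Set.mem_sdiff, Set.mem_insert_iff, true_or, and_true,
          iff_true, Set.mem_singleton_iff, not_or]
        refine ⟨hxC.1, ?_, ?_⟩ <;> rintro rfl
        · exact hyN.1 hxC
        · exact htN.1 hxC
      · simp [hv]; tauto
    refine hno ⟨(c.1 \ {y, t}, insert x c.2),
      isSeparation_thin (hess c hc) hyN.1 htN.1 hy ht, ?_, ?_, ?_, ?_⟩
    · rw [hint]
      exact (((hess c hc).2.1).subset Set.sdiff_subset).insert _
    · rw [hint, sepOrder]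
      rw [hS] at hyN htN
      have hf := (hess c hc).2.1
      have h1 := Set.ncard_insert_le x ((c.1 ∩ c.2) \ {y, t})
      have h2 := Set.ncard_sdiff_add_ncard_of_subset
        (Set.insert_subset hyN (Set.singleton_subset_iff.2 htN)) hf
      rw [Set.ncard_pair hyt] at h2
      omega
    · exact containsEnd_sdiff_finite he1 (by simp)
    · obtain ⟨r, hr, hr'⟩ := he2
      exact ⟨r, hr, fun n => Or.inr (hr' n)⟩

end CutSystems

/-- The block property, in terms of wings. -/
def WingBlock (G : SimpleGraph V) (Wg : Set V → Prop) (X : Set V) : Prop :=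
  (∀ D, Wg D → (X ⊆ D ∪ Nbhd G D ∨ Disjoint X D) ∧ ¬ X ⊆ Nbhd G D) ∧
  ∃ C, Wg C ∧ X ⊆ C ∪ Nbhd G C ∧ Nbhd G C ⊆ X

lemma blockProp_iff {𝒞 : Set (Set V × Set V)} (hess : ∀ c ∈ 𝒞, IsEssential G c) {X : Set V} :
    BlockProp 𝒞 X ↔ WingBlock G (IsLeftWing 𝒞) X := by
  have h1 : ∀ c ∈ 𝒞, ((X ⊆ c.1 ↔ X ⊆ c.1 \ c.2 ∪ Nbhd G (c.1 \ c.2)) ∧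
      (X ⊆ c.2 ↔ Disjoint X (c.1 \ c.2))) ∧ (X ⊆ Nbhd G (c.1 \ c.2) ↔ X ⊆ c.1 ∧ X ⊆ c.2) := by
    intro c hc
    refine ⟨⟨by rw [← fst_eq (hess c hc)], ?_⟩, ?_⟩
    · conv_lhs => rw [snd_eq (hess c hc)]
      exact Set.subset_compl_iff_disjoint_right
    · rw [nbhd_leftWing (hess c hc), Set.subset_inter_iff]
  constructor
  · rintro ⟨h, c, hc, hX⟩
    refine ⟨?_, _, ⟨c, hc, rfl⟩, (h1 c hc).1.1.1 hX.1, nbhd_leftWing (hess c hc) ▸ hX.2⟩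
    rintro _ ⟨d, hd, rfl⟩
    rw [← (h1 d hd).1.1, ← (h1 d hd).1.2, (h1 d hd).2]
    exact h d hd
  · rintro ⟨h, _, ⟨c, hc, rfl⟩, hX⟩
    refine ⟨fun d hd => ?_, c, hc, (h1 c hc).1.1.2 hX.1, nbhd_leftWing (hess c hc) ▸ hX.2⟩
    have := h _ ⟨d, hd, rfl⟩
    rwa [← (h1 d hd).1.1, ← (h1 d hd).1.2, (h1 d hd).2] at this

/-- A maximal set with the block property. -/
def MaxWingBlock (G : SimpleGraph V) (Wg : Set V → Prop) (X : Set V) : Prop :=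
  WingBlock G Wg X ∧ ∀ Y, X ⊆ Y → WingBlock G Wg Y → Y = X

namespace WingSystem

variable {Wg : Set V → Prop} (h : WingSystem G Wg) {A B C D K Z : Set V}

include h

lemma exists_wing_of_block (hZ : WingBlock G Wg Z) (hC : Wg C) (hCZ : Nbhd G C ⊆ Z) :
    ∃ D, Wg D ∧ Nbhd G D = Nbhd G C ∧ Z ⊆ D ∪ Nbhd G D := by
  obtain ⟨hZ1, C', hC', hZC', hC'Z⟩ := hZ
  by_contra hno
  push Not at hno
  have hdis : ∀ D, Wg D → Nbhd G D = Nbhd G C → Disjoint Z D := fun D hD hN =>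
    (hZ1 D hD).1.resolve_left (hno D hD hN)
  have hne : ¬ Nbhd G C' ⊆ Nbhd G C := by
    intro hs
    have hN := h.nbhd_eq_of_subset hC' hC hs
    refine (hZ1 C' hC').2 fun z hz => (hZC' hz).resolve_left fun hzC => ?_
    exact Set.disjoint_left.1 (hdis C' hC' hN) hz hzC
  obtain ⟨s, hs, hsC⟩ := Set.not_subset.1 hne
  obtain ⟨C'', hC'', hne', hN'⟩ := h.other hC'
  obtain ⟨K, hK, hKN, -, hKs⟩ := h.exists_extension hC' hC'' hN' hne' hC (hCZ.trans hZC')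
  exact Set.disjoint_left.1 (hdis K hK hKN) (hC'Z hs) (hKs s hs hsC)

lemma exists_maxBlock (hC : Wg C) {X : Set V} (hX : WingBlock G Wg X) (hCX : Nbhd G C ⊆ X)
    (hXC : X ⊆ C ∪ Nbhd G C) :
    ∃ U, MaxWingBlock G Wg U ∧ Nbhd G C ⊆ U ∧ U ⊆ C ∪ Nbhd G C ∧
      ∀ Z, MaxWingBlock G Wg Z → Nbhd G C ⊆ Z → Z ⊆ C ∪ Nbhd G C → Z = U := by
  set 𝓕 : Set (Set V) := {Y | WingBlock G Wg Y ∧ Nbhd G C ⊆ Y ∧ Y ⊆ C ∪ Nbhd G C} with h𝓕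
  have hXF : X ∈ 𝓕 := ⟨hX, hCX, hXC⟩
  have hXU : X ⊆ ⋃₀ 𝓕 := Set.subset_sUnion_of_mem hXF
  have hSU : Nbhd G C ⊆ ⋃₀ 𝓕 := hCX.trans hXU
  have hUC : ⋃₀ 𝓕 ⊆ C ∪ Nbhd G C := Set.sUnion_subset fun Y hY => hY.2.2
  have hU : WingBlock G Wg (⋃₀ 𝓕) := by
    refine ⟨fun D hD => ⟨?_, fun hs => (hX.1 D hD).2 (hXU.trans hs)⟩, C, hC, hUC, hSU⟩
    by_cases hmeet : ∃ Y ∈ 𝓕, ¬ Disjoint Y D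
    · obtain ⟨Y, hY, hYD⟩ := hmeet
      have hYD' := ((hY.1.1 D hD).1).resolve_right hYD
      refine Or.inl (Set.sUnion_subset fun Y' hY' => ?_)
      refine ((hY'.1.1 D hD).1).resolve_right fun hdis => ?_
      have hN : Nbhd G C = Nbhd G D := by
        refine h.nbhd_eq_of_subset hC hD fun s hs => (hYD' (hY.2.1 hs)).resolve_left fun hsD => ?_
        exact Set.disjoint_left.1 hdis (hY'.2.1 hs) hsD
      obtain ⟨a, haY, haD⟩ := Set.not_disjoint_iff.1 hYD
      have haC : a ∈ C := (hY.2.2 haY).resolve_right fun ha =>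
        Set.disjoint_left.1 (disjoint_nbhd D) haD (hN ▸ ha)
      have hCD := h.eq_of_mem hC hD hN haC haD
      subst hCD
      exact (hY'.1.1 C hC).2 fun z hz => (hY'.2.2 hz).resolve_left fun hzC =>
        Set.disjoint_left.1 hdis hz hzC
    · push Not at hmeet
      exact Or.inr (Set.disjoint_sUnion_left.2 fun Y hY => hmeet Y hY)
  refine ⟨⋃₀ 𝓕, ⟨hU, fun Y hUY hY => ?_⟩, hSU, hUC, fun Z hZ hCZ hZC => ?_⟩
  · suffices hYC : Y ⊆ C ∪ Nbhd G C by
      exact (Set.subset_sUnion_of_mem (show Y ∈ 𝓕 from ⟨hY, hSU.trans hUY, hYC⟩)).antisymm hUY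
    refine (hY.1 C hC).1.resolve_right fun hdis => (hU.1 C hC).2 fun z hz => ?_
    exact (hUC hz).resolve_left fun hzC => Set.disjoint_left.1 hdis (hUY hz) hzC
  · exact (hZ.2 _ (Set.subset_sUnion_of_mem (show Z ∈ 𝓕 from ⟨hZ.1, hCZ, hZC⟩)) hU).symm

/-- The conditions on a vertex of the wing `C` to lie in a block of `C` and its separator. -/
lemma exists_block_of_mem (hC : Wg C) {w : V} (hw : w ∈ C)
    (ha : ∀ D, Wg D → Disjoint D (Nbhd G C) → D ≠ C → w ∉ D)
    (hb : ∀ D, Wg D → ¬ Disjoint (Nbhd G C) D → w ∈ D ∪ Nbhd G D) :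
    ∃ X, WingBlock G Wg X ∧ Nbhd G C ⊆ X ∧ X ⊆ C ∪ Nbhd G C := by
  set X : Set V := {v | v ∈ C ∪ Nbhd G C ∧
    ∀ D, Wg D → (Disjoint D (Nbhd G C) → D ≠ C → v ∉ D) ∧
      (¬ Disjoint (Nbhd G C) D → v ∈ D ∪ Nbhd G D)} with hX
  have hXC : X ⊆ C ∪ Nbhd G C := fun v hv => hv.1
  have hSX : Nbhd G C ⊆ X := fun s hs => ⟨Or.inr hs, fun D hD =>
    ⟨fun hdis _ hsD => Set.disjoint_left.1 hdis hsD hs,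
      fun hnd => (h.nest hD hC).resolve_right hnd hs⟩⟩
  have hwX : w ∈ X := ⟨Or.inl hw, fun D hD => ⟨ha D hD, hb D hD⟩⟩
  refine ⟨X, ⟨fun D hD => ⟨?_, fun hs => ?_⟩, C, hC, hXC, hSX⟩, hSX, hXC⟩
  · by_cases hdis : Disjoint D (Nbhd G C)
    · by_cases hDC : D = C
      · exact Or.inl (hDC ▸ hXC)
      · exact Or.inr (Set.disjoint_left.2 fun v hv => (hv.2 D hD).1 hdis hDC)
    · exact Or.inl fun v hv => (hv.2 D hD).2 fun h => hdis h.symm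
  · have h1 := h.card hC hD
    have h2 : (insert w (Nbhd G C)).ncard ≤ (Nbhd G D).ncard :=
      Set.ncard_le_ncard ((Set.insert_subset hwX hSX).trans hs) (h.fin hD)
    rw [Set.ncard_insert_of_notMem (fun hw' => hw'.1 hw) (h.fin hC)] at h2
    omega

lemma exists_block_of_minimal (hC : Wg C) (hmin : ∀ D, Wg D → D ⊆ C → D = C) :
    ∃ X, WingBlock G Wg X ∧ Nbhd G C ⊆ X ∧ X ⊆ C ∪ Nbhd G C := by
  obtain ⟨w, hw⟩ := (h.conn hC).1
  refine h.exists_block_of_mem hC hw (fun D hD hdis hDC hwD => ?_) (fun D hD hnd => ?_)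
  · exact hDC (hmin D hD ((h.conn hD).subset_of_disjoint hdis hwD hw))
  · by_contra hwD
    obtain ⟨s, hsS, hsD⟩ := Set.not_disjoint_iff.1 hnd
    have hSD := (h.nest hD hC).resolve_right hnd
    have hNne : Nbhd G D ≠ Nbhd G C := fun hN => (hN ▸ hsS : s ∈ Nbhd G D).1 hsD
    obtain ⟨K, hK, hKD, hKN⟩ := h.other hD
    have hKdis : Disjoint K (Nbhd G C) := Disjoint.mono_right hSD
      (Set.disjoint_union_right.2 ⟨h.disjoint_of_ne hK hD hKN hKD, hKN ▸ disjoint_nbhd K⟩)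
    have hKC : Disjoint K C := Set.disjoint_left.2 fun a haK haC => by
      have := hmin K hK ((h.conn hK).subset_of_disjoint hKdis haK haC)
      exact hNne (by rw [← hKN, this])
    rcases h.nest hC hD with hn | hn
    · obtain ⟨n, hnD, hnC⟩ := Set.not_subset.1
        fun hs => hNne (h.nbhd_eq_of_subset hD hC hs)
      obtain ⟨k, hk, hnk⟩ := exists_adj_of_mem_nbhd (hKN ▸ hnD : n ∈ Nbhd G K)
      rcases mem_or_mem_nbhd ((hn hnD).resolve_right hnC) hnk with hk' | hk'
      · exact Set.disjoint_left.1 hKC hk hk'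
      · exact Set.disjoint_left.1 hKdis hk hk'
    · obtain ⟨c, hc, hsc⟩ := exists_adj_of_mem_nbhd hsS
      have hcD := mem_of_adj hsD hsc (Set.disjoint_right.1 hn hc)
      exact hwD (Or.inl ((h.conn hC).subset_of_disjoint hn.symm hc hcD hw))

lemma minSep_nbhd (hC : Wg C) (hB : Wg B) (hN : Nbhd G B = Nbhd G C) (hBC : B ≠ C) (hD : Wg D)
    (hDC : D ⊆ C) {v y : V} (hv : v ∈ D) (hy : y ∈ B) : MinSep G ∅ v y (Nbhd G D) := by
  have hyD : y ∉ D := fun hyD => Set.disjoint_left.1 (h.disjoint_of_ne hB hC hN hBC) hy (hDC hyD)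
  have hDS : Nbhd G D ⊆ C ∪ Nbhd G C := fun s hs => by
    obtain ⟨a, ha, hsa⟩ := exists_adj_of_mem_nbhd hs
    exact mem_or_mem_nbhd (hDC ha) hsa.symm
  obtain ⟨M, hM, hMN, hBM, -⟩ := h.exists_extension hC hB hN hBC hD hDS
  refine ⟨fun hav => ?_, fun s hs => ?_⟩
  · rw [Set.empty_union] at hav
    have : ∀ z, Avoids G (Nbhd G D) v z → z ∈ D := by
      intro z hz
      induction hz with
      | refl => exact hv
      | tail _ hab ih => exact mem_of_adj ih hab.1 hab.2
    exact hyD (this y hav)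
  · rw [Set.empty_union]
    obtain ⟨a, ha, hsa⟩ := exists_adj_of_mem_nbhd hs
    obtain ⟨b, hb, hsb⟩ := exists_adj_of_mem_nbhd (hMN ▸ hs : s ∈ Nbhd G M)
    have h1 : Avoids G (Nbhd G D \ {s}) v a :=
      ((h.conn hD).avoids (disjoint_nbhd D) hv ha).mono Set.sdiff_subset
    have h2 : Avoids G (Nbhd G D \ {s}) b y :=
      ((h.conn hM).avoids (hMN ▸ disjoint_nbhd M) hb (hBM hy)).mono Set.sdiff_subset
    exact ((h1.tail ⟨hsa.symm, fun h => h.2 rfl⟩).tail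
      ⟨hsb, fun h => Set.disjoint_left.1 (disjoint_nbhd M) hb (hMN ▸ h.1)⟩).trans h2

lemma finite_subwings (hC : Wg C) (v : V) : {D | Wg D ∧ D ⊆ C ∧ v ∈ D}.Finite := by
  obtain ⟨B, hB, hBC, hN⟩ := h.other hC
  obtain ⟨y, hy⟩ := (h.conn hB).1
  refine Set.Finite.of_finite_image (f := Nbhd G)
    ((finite_minSep (G := G) (Nbhd G C).ncard ∅ v y).subset ?_) ?_
  · rintro _ ⟨D, ⟨hD, hDC, hv⟩, rfl⟩
    exact ⟨h.fin hD, h.card hD hC, h.minSep_nbhd hC hB hN hBC hD hDC hv hy⟩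
  · rintro D ⟨hD, -, hv⟩ D' ⟨hD', -, hv'⟩ hDD'
    exact h.eq_of_mem hD hD' hDD' hv hv'

theorem exists_block (hC : Wg C) :
    ∃ X, WingBlock G Wg X ∧ Nbhd G C ⊆ X ∧ X ⊆ C ∪ Nbhd G C := by
  by_cases hmin : ∀ D, Wg D → D ⊆ C → D = C
  · exact h.exists_block_of_minimal hC hmin
  push Not at hmin
  obtain ⟨D₁, hD₁, hD₁C, hD₁ne⟩ := hmin
  obtain ⟨v, hv⟩ := (h.conn hD₁).1
  obtain ⟨B, hB, hBC, hBN⟩ := h.other hC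
  have hBCdis := h.disjoint_of_ne hB hC hBN hBC
  obtain ⟨y, hy⟩ := (h.conn hB).1
  obtain ⟨D₀, ⟨⟨hD₀, hD₀C, hvD₀⟩, hD₀ne⟩, hmax⟩ := Set.Finite.exists_maximal
    (s := {D | (Wg D ∧ D ⊆ C ∧ v ∈ D) ∧ D ≠ C})
    ((h.finite_subwings hC v).subset fun D hD => hD.1) ⟨D₁, ⟨hD₁, hD₁C, hv⟩, hD₁ne⟩
  have hD₀S : Nbhd G D₀ ⊆ C ∪ Nbhd G C := fun s hs => by
    obtain ⟨a, ha, hsa⟩ := exists_adj_of_mem_nbhd hs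
    exact mem_or_mem_nbhd (hD₀C ha) hsa.symm
  obtain ⟨w, hwD₀, hwS⟩ := Set.not_subset.1 fun hs => hD₀ne
    (h.eq_of_mem hD₀ hC (h.nbhd_eq_of_subset hD₀ hC hs) hvD₀ (hD₀C hvD₀))
  have hwC : w ∈ C := (hD₀S hwD₀).resolve_right hwS
  obtain ⟨M, hM, hMN, hBM, hMS⟩ := h.exists_extension hC hB hBN hBC hD₀ hD₀S
  have hMD₀ : M ≠ D₀ := fun he => Set.disjoint_left.1 hBCdis hy (hD₀C (he ▸ hBM hy))
  have hMdis : Disjoint M (D₀ ∪ Nbhd G D₀) := Set.disjoint_union_right.2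
    ⟨h.disjoint_of_ne hM hD₀ hMN hMD₀, hMN ▸ disjoint_nbhd M⟩
  have ha : ∀ D, Wg D → Disjoint D (Nbhd G C) → D ≠ C → w ∉ D := by
    intro D hD hdis hDC hwD
    have hDsub := (h.conn hD).subset_of_disjoint hdis hwD hwC
    rcases h.nest hD₀ hD with hn | hn
    · have hMD := hMdis.mono_right hn
      obtain ⟨m, hm, hwm⟩ := exists_adj_of_mem_nbhd (hMN ▸ hwD₀ : w ∈ Nbhd G M)
      have := (h.conn hM).subset_of_disjoint hMD hm
        (mem_of_adj hwD hwm (Set.disjoint_left.1 hMD hm))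
      exact Set.disjoint_left.1 hBCdis hy (hDsub (this (hBM hy)))
    · obtain ⟨a, ha, hwa⟩ := exists_adj_of_mem_nbhd hwD₀
      have hsub := (h.conn hD₀).subset_of_disjoint hn.symm ha
        (mem_of_adj hwD hwa (Set.disjoint_right.1 hn ha))
      exact hwD₀.1 (hmax ⟨⟨hD, hDsub, hsub hvD₀⟩, hDC⟩ hsub hwD)
  refine h.exists_block_of_mem hC hwC ha fun D hD hnd => ?_
  by_contra hwD
  have hSD := (h.nest hD hC).resolve_right hnd
  obtain ⟨s, hsS, hsD⟩ := Set.not_disjoint_iff.1 hnd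
  have hn₀ := (h.nest hD hD₀).resolve_left fun hs => hwD (hs hwD₀)
  have hsM := hMS s hsS fun hs => Set.disjoint_left.1 hn₀ hs hsD
  rcases h.nest hD₀ hD with hn | hn
  · have hMD := hMdis.mono_right hn
    have h1 := (h.conn hM).subset_of_disjoint hMD hsM hsD
    have h2 := (h.conn hD).subset_of_disjoint (hMN ▸ hn₀.symm) hsD hsM
    have he : M = D := h1.antisymm h2
    exact hwD (Or.inr (he ▸ hMN ▸ hwD₀))
  · obtain ⟨K, hK, hKN, hDK⟩ := h.ext hD hD₀ hn.symm
    obtain ⟨a, ha₀, hwa⟩ := exists_adj_of_mem_nbhd hwD₀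
    have hwK : w ∈ K := mem_of_adj (hDK ha₀) hwa.symm fun hw => hwD (Or.inr (hKN ▸ hw))
    have hKD : K ≠ D := fun he => hwD (Or.inl (he ▸ hwK))
    refine ha K hK (Disjoint.mono_right hSD (Set.disjoint_union_right.2
      ⟨h.disjoint_of_ne hK hD hKN hKD, hKN ▸ disjoint_nbhd K⟩)) (fun he => ?_) hwK
    subst he
    exact (hKN ▸ hsS : s ∈ Nbhd G D).1 hsD

theorem exists_two_blocks (hC : Wg C)
    (h2 : ∀ A B D, Wg A → Wg B → Wg D → Nbhd G A = Nbhd G C → Nbhd G B = Nbhd G C →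
      Nbhd G D = Nbhd G C → A ≠ B → D = A ∨ D = B) :
    ∃ X Y, X ≠ Y ∧ MaxWingBlock G Wg X ∧ MaxWingBlock G Wg Y ∧ Nbhd G C ⊆ X ∧ Nbhd G C ⊆ Y ∧
      ∀ Z, MaxWingBlock G Wg Z → Nbhd G C ⊆ Z → Z = X ∨ Z = Y := by
  obtain ⟨B, hB, hBC, hN⟩ := h.other hC
  obtain ⟨X₀, hX₀, hCX₀, hX₀C⟩ := h.exists_block hC
  obtain ⟨Y₀, hY₀, hBY₀, hY₀B⟩ := h.exists_block hB
  obtain ⟨X, hX, hCX, hXC, hXu⟩ := h.exists_maxBlock hC hX₀ hCX₀ hX₀C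
  obtain ⟨Y, hY, hBY, hYB, hYu⟩ := h.exists_maxBlock hB hY₀ hBY₀ hY₀B
  refine ⟨X, Y, ?_, hX, hY, hCX, hN ▸ hBY, fun Z hZ hCZ => ?_⟩
  · rintro rfl
    refine (hX.1.1 C hC).2 fun x hx => (hXC hx).resolve_left fun hxC => ?_
    rcases hYB hx with hxB | hxB
    · exact Set.disjoint_left.1 (h.disjoint_of_ne hB hC hN hBC) hxB hxC
    · exact (hN ▸ hxB : x ∈ Nbhd G C).1 hxC
  · obtain ⟨D, hD, hDN, hZD⟩ := h.exists_wing_of_block hZ.1 hC hCZ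
    rcases h2 C B D hC hB hD rfl hN hDN hBC.symm with rfl | rfl
    · exact Or.inl (hXu Z hZ hCZ hZD)
    · exact Or.inr (hYu Z hZ (hN ▸ hCZ) hZD)

end WingSystem

/-- `G` is the underlying graph of the triangle-free C-homogeneous digraph with edge relation
`E`. -/
structure IsCHomGraph (G : SimpleGraph V) (E : V → V → Prop) : Prop where
  adj : ∀ {x y}, G.Adj x y ↔ E x y ∨ E y x
  asymm : ∀ {x y}, E x y → ¬ E y x
  triangleFree : ∀ {x y z}, G.Adj x y → G.Adj y z → ¬ G.Adj x z
  hom : ∀ (X : Set V) (f : V → V), X.Finite → ConnectedSet G X → Set.InjOn f X →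
    (∀ a ∈ X, ∀ b ∈ X, E a b ↔ E (f a) (f b)) →
    ∃ ψ : G ≃g G, (∀ x y, E (ψ x) (ψ y) ↔ E x y) ∧ ∀ a ∈ X, ψ a = f a

theorem isCHomGraph {E : V → V → Prop} (hD : IsDigraph E) (hhom : DigraphCHom E)
    (htf : ¬ HasTriangle E) : IsCHomGraph (UG E) E := by
  have hadj : ∀ x y, (UG E).Adj x y ↔ E x y ∨ E y x := fun x y => by
    rw [UG, SimpleGraph.fromRel_adj, and_iff_right_iff_imp]
    rintro (h | h) rfl <;> exact hD.1 _ h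
  refine ⟨hadj _ _, hD.2 _ _, fun h1 h2 h3 => htf ⟨_, _, _, h1, h2, h3⟩, ?_⟩
  intro X f hX hconn hinj hE
  obtain ⟨ψ, hψ, hψX⟩ := hhom X (f '' X) hX (hX.image f) (connectedSet_iff.2 hconn)
    (Equiv.Set.imageOfInjOn f X hinj) (fun a b => hE a a.2 b b.2)
  exact ⟨⟨ψ, by simp [hadj, hψ]⟩, hψ, fun a ha => hψX ⟨a, ha⟩⟩

namespace IsCHomGraph

variable {E : V → V → Prop} (e : IsCHomGraph G E) {x y a b x' y' a' b' : V}

include e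

lemma flip : IsCHomGraph G fun x y => E y x :=
  ⟨e.adj.trans or_comm, fun h => e.asymm h, e.triangleFree, fun X f hX hc hf hE =>
    let ⟨ψ, hψ, hψX⟩ := e.hom X f hX hc hf fun a ha b hb => hE b hb a ha
    ⟨ψ, fun x y => hψ y x, hψX⟩⟩

lemma irrefl (x : V) : ¬ E x x := fun h => e.asymm h h

lemma adj_of (h : E x y) : G.Adj x y := e.adj.2 (Or.inl h)

lemma adj_of' (h : E x y) : G.Adj y x := e.adj.2 (Or.inr h)

lemma exists_map (x x' : V) : ∃ ψ : G ≃g G, (∀ x y, E (ψ x) (ψ y) ↔ E x y) ∧ ψ x = x' := by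
  obtain ⟨ψ, hψ, h⟩ := e.hom {x} (fun _ => x') (by simp) (connectedSet_singleton x) (by simp)
    (by simp [e.irrefl])
  exact ⟨ψ, hψ, h x rfl⟩

lemma exists_map_edge (h : E x y) (h' : E x' y') :
    ∃ ψ : G ≃g G, (∀ x y, E (ψ x) (ψ y) ↔ E x y) ∧ ψ x = x' ∧ ψ y = y' := by
  classical
  have hyx : y ≠ x := (e.adj_of' h).ne
  have hyx' : y' ≠ x' := (e.adj_of' h').ne
  obtain ⟨ψ, hψ, hX⟩ := e.hom (insert y {x}) (fun v => if v = x then x' else y') (by simp)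
    ((connectedSet_singleton x).insert_adj rfl (e.adj_of h))
    (by
      rintro p (rfl | rfl) q (rfl | rfl) <;> simp [hyx, hyx', hyx'.symm])
    (by
      rintro p (rfl | rfl) q (rfl | rfl) <;>
        simp [hyx, e.irrefl, h, h', e.asymm h, e.asymm h'])
  exact ⟨ψ, hψ, by simpa using hX x (by simp), by simpa [hyx] using hX y (by simp)⟩

lemma exists_map_cherry (ha : G.Adj x a) (hb : G.Adj x b) (hab : a ≠ b) (ha' : G.Adj x' a')
    (hb' : G.Adj x' b') (hab' : a' ≠ b') (hEa : E x a ↔ E x' a') (hEb : E x b ↔ E x' b') :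
    ∃ ψ : G ≃g G, (∀ x y, E (ψ x) (ψ y) ↔ E x y) ∧ ψ x = x' ∧ ψ a = a' ∧ ψ b = b' := by
  classical
  have h1 : ∀ {x a}, G.Adj x a → (E a x ↔ ¬ E x a) := fun {x a} h =>
    ⟨fun h1 h2 => e.asymm h1 h2, fun h1 => (e.adj.1 h).resolve_left h1⟩
  have nonadj : ∀ {x a b}, G.Adj x a → G.Adj x b → ¬ E a b := fun h h' hE =>
    e.triangleFree h.symm h' (e.adj_of hE)
  obtain ⟨ψ, hψ, hX⟩ := e.hom (insert b (insert a {x}))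
    (fun v => if v = x then x' else if v = a then a' else b') (by simp)
    (((connectedSet_singleton x).insert_adj rfl ha).insert_adj (x := x) (by simp) hb)
    (by
      rintro p (rfl | rfl | rfl) q (rfl | rfl | rfl) <;>
        simp [ha.ne', hb.ne', hab.symm, ha'.ne', hb'.ne', hab', hab'.symm, ha'.ne, hb'.ne])
    (by
      rintro p (rfl | rfl | rfl) q (rfl | rfl | rfl) <;>
        simp [ha.ne', hb.ne', hab.symm, e.irrefl, h1 ha, h1 hb, h1 ha', h1 hb', hEa, hEb,
          nonadj ha hb, nonadj hb ha, nonadj ha' hb', nonadj hb' ha'])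
  exact ⟨ψ, hψ, by simpa using hX x (by simp), by simpa [ha.ne'] using hX a (by simp),
    by simpa [hb.ne', hab.symm] using hX b (by simp)⟩

end IsCHomGraph

/-- `x` lies in the separator of two wings, one containing `a` and the other containing `b`. -/
def Splits (G : SimpleGraph V) (Wg : Set V → Prop) (x a b : V) : Prop :=
  ∃ C D, Wg C ∧ Wg D ∧ C ≠ D ∧ Nbhd G C = Nbhd G D ∧ x ∈ Nbhd G C ∧ a ∈ C ∧ b ∈ D

section Splits

variable {Wg : Set V → Prop} {x a b : V}

lemma Splits.symm (hs : Splits G Wg x a b) : Splits G Wg x b a :=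
  let ⟨C, D, hC, hD, hCD, hN, hx, ha, hb⟩ := hs
  ⟨D, C, hD, hC, hCD.symm, hN.symm, hN ▸ hx, hb, ha⟩

lemma Splits.map (h : WingSystem G Wg) (hs : Splits G Wg x a b) (ψ : G ≃g G) :
    Splits G Wg (ψ x) (ψ a) (ψ b) := by
  obtain ⟨C, D, hC, hD, hCD, hN, hx, ha, hb⟩ := hs
  refine ⟨ψ '' C, ψ '' D, h.aut ψ hC, h.aut ψ hD, ψ.injective.image_injective.ne hCD, ?_, ?_,
    Set.mem_image_of_mem _ ha, Set.mem_image_of_mem _ hb⟩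
  · rw [nbhd_image, nbhd_image, hN]
  · rw [nbhd_image]
    exact Set.mem_image_of_mem _ hx

lemma Splits.map_iff (h : WingSystem G Wg) (ψ : G ≃g G) :
    Splits G Wg (ψ x) (ψ a) (ψ b) ↔ Splits G Wg x a b :=
  ⟨fun hs => by simpa using hs.map h ψ.symm, fun hs => hs.map h ψ⟩

lemma Splits.notMem (h : WingSystem G Wg) (hs : Splits G Wg x a b) {K : Set V} (hK : Wg K)
    (ha : a ∈ Nbhd G K) : b ∉ Nbhd G K := by
  obtain ⟨C, D, hC, hD, hCD, hN, -, haC, hbD⟩ := hs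
  intro hb
  rcases h.nest hC hK with hn | hn
  · rcases hn hb with hb' | hb'
    · exact Set.disjoint_left.1 (h.disjoint_of_ne hC hD hN hCD) hb' hbD
    · exact (hN ▸ hb' : b ∈ Nbhd G D).1 hbD
  · exact Set.disjoint_left.1 hn ha haC

end Splits

section InOut

variable {Wg : Set V → Prop} {E : V → V → Prop}

lemma splits_in_out_aux (h : WingSystem G Wg) (e : IsCHomGraph G E)
    (hno : ∀ u y a, E u y → E y a → ¬ Splits G Wg y u a) {C : Set V} (hC : Wg C) {y a : V}
    (hy : y ∈ Nbhd G C) (ha : a ∈ C) (hya : E y a) : False := by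
  have hout : ∀ (C D : Set V) (y a : V), Wg C → Wg D → Nbhd G D = Nbhd G C → y ∈ Nbhd G C →
      a ∈ C → E y a → ∀ b ∈ D, ¬ E b y := by
    have hne : ∀ (C D : Set V) (y a : V), Wg C → Wg D → Nbhd G D = Nbhd G C → D ≠ C →
        y ∈ Nbhd G C → a ∈ C → E y a → ∀ b ∈ D, ¬ E b y :=
      fun C D y a hC hD hN hDC hy ha hya b hb hby =>
        hno b y a hby hya ⟨D, C, hD, hC, hDC, hN, hN ▸ hy, hb, ha⟩
    intro C D y a hC hD hN hy ha hya
    by_cases hDC : D = C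
    · subst hDC
      obtain ⟨K, hK, hKD, hKN⟩ := h.other hC
      obtain ⟨k, hk, hyk⟩ := exists_adj_of_mem_nbhd (hKN ▸ hy : y ∈ Nbhd G K)
      have hyk' := (e.adj.1 hyk).resolve_right (hne D K y a hC hK hKN hKD hy ha hya k hk)
      exact hne K D y k hK hC hKN.symm hKD.symm (hKN ▸ hy) hk hyk'
    · exact hne C D y a hC hD hN hDC hy ha hya
  have step : ∀ (u y : V), E u y → ∀ C, Wg C → y ∈ Nbhd G C → (∃ a ∈ C, E y a) →
      ∃ K, Wg K ∧ Nbhd G K = Nbhd G C ∧ u ∈ Nbhd G K ∧ ∃ a ∈ K, E u a := by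
    rintro u y huy C hC hy ⟨a, ha, hya⟩
    obtain ⟨ψ, hψ, hψu, hψy⟩ := e.exists_map_edge huy hya
    have haN : a ∈ Nbhd G (ψ '' C) := by
      rw [nbhd_image]; exact ⟨y, hy, hψy⟩
    have hsub := (h.nest hC (h.aut ψ hC)).resolve_right fun hd => Set.disjoint_left.1 hd haN ha
    obtain ⟨B, hB, hBC, hBN⟩ := h.other hC
    obtain ⟨K, hK, hKN, hBK, hKS⟩ := h.exists_extension hC hB hBN hBC (h.aut ψ hC) hsub
    have hK' : Wg (ψ.symm '' K) := h.aut ψ.symm hK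
    have hN' : Nbhd G (ψ.symm '' K) = Nbhd G C := by
      rw [nbhd_image, hKN, nbhd_image, image_inv_image]
    have hu : ψ.symm y = u := by rw [← hψu]; simp
    have huC : u ∈ Nbhd G C := by
      by_contra huC
      have hyK : y ∈ K := hKS y hy fun hyN => by
        rw [nbhd_image] at hyN
        obtain ⟨z, hz, hzy⟩ := hyN
        have hzu : z = u := ψ.injective (hzy.trans hψu.symm)
        exact huC (hzu ▸ hz)
      exact hout C _ y a hC hK' hN' hy ha hya u ⟨y, hyK, hu⟩ huy
    obtain ⟨b, hb, hyb⟩ := exists_adj_of_mem_nbhd (hBN ▸ hy : y ∈ Nbhd G B)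
    have hyb' := (e.adj.1 hyb).resolve_right (hout C B y a hC hB hBN hy ha hya b hb)
    refine ⟨ψ.symm '' K, hK', hN', hN' ▸ huC, ψ.symm b, ⟨b, hBK hb, rfl⟩, ?_⟩
    rw [← hψ, hψu]
    simpa using hyb'
  set Anc : V → Set V := fun y => {w | Relation.ReflTransGen E w y} with hAnc
  have hsub : Anc y ⊆ Nbhd G C := by
    intro w hw
    have : ∃ K, Wg K ∧ Nbhd G K = Nbhd G C ∧ w ∈ Nbhd G K ∧ ∃ a ∈ K, E w a := by
      induction hw using Relation.ReflTransGen.head_induction_on with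
      | refl => exact ⟨C, hC, rfl, hy, a, ha, hya⟩
      | head huv _ ih =>
        obtain ⟨K, hK, hKN, hv, hex⟩ := ih
        obtain ⟨K', hK', hKN', hu⟩ := step _ _ huv K hK hv hex
        exact ⟨K', hK', hKN'.trans hKN, hu⟩
    obtain ⟨K, -, hKN, hw, -⟩ := this
    exact hKN ▸ hw
  obtain ⟨ψ, hψ, hψy⟩ := e.exists_map y a
  have himg : Anc a ⊆ ψ '' Anc y := by
    intro w hw
    refine ⟨ψ.symm w, ?_, by simp⟩
    have : Relation.ReflTransGen E (ψ.symm w) (ψ.symm a) :=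
      Relation.ReflTransGen.lift ψ.symm
        (fun p q (hpq : E p q) => show E (ψ.symm p) (ψ.symm q) by rw [← hψ]; simpa using hpq) _ _ hw
    rwa [← hψy, RelIso.symm_apply_apply] at this
  have hfin : (Anc y).Finite := (h.fin hC).subset hsub
  have heq : Anc y = Anc a := by
    refine Set.eq_of_subset_of_ncard_le (fun w hw => hw.tail hya) ?_ ((hfin.image ψ).subset himg)
    exact (Set.ncard_le_ncard himg (hfin.image ψ)).trans (Set.ncard_image_le hfin)
  have haa : a ∈ Anc a := Relation.ReflTransGen.refl
  rw [← heq] at haa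
  exact (hsub haa).1 ha

/-- Every directed path `u → y → a` is split by a separator through `y`. -/
theorem splits_in_out (h : WingSystem G Wg) (e : IsCHomGraph G E) {C : Set V} (hC : Wg C)
    {u y a : V} (huy : E u y) (hya : E y a) : Splits G Wg y u a := by
  by_contra hno
  have hno' : ∀ u y a, E u y → E y a → ¬ Splits G Wg y u a := by
    intro u' y' a' hu' ha' hs
    have hne : ∀ {u y a}, E u y → E y a → u ≠ a := by
      rintro u y _ h1 h2 rfl
      exact e.asymm h1 h2
    obtain ⟨ψ, -, rfl, rfl, rfl⟩ := e.exists_map_cherry (e.adj_of' huy) (e.adj_of hya)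
      (hne huy hya) (e.adj_of' hu') (e.adj_of ha') (hne hu' ha')
      (iff_of_false (e.asymm huy) (e.asymm hu')) (iff_of_true hya ha')
    exact hno ((Splits.map_iff h ψ).1 hs)
  obtain ⟨s, hs⟩ := h.nbhd_nonempty hC
  obtain ⟨b, hb, hsb⟩ := exists_adj_of_mem_nbhd hs
  rcases e.adj.1 hsb with hsb | hsb
  · exact splits_in_out_aux h e hno' hC hs hb hsb
  · exact splits_in_out_aux h e.flip (fun u y a h1 h2 hsp => hno' a y u h2 h1 hsp.symm)
      hC hs hb hsb

end InOut

section Acyclic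

variable {Wg : Set V → Prop}

lemma path_induction {T : Set V} {p : ℕ → V} {m n : ℕ} (hmn : m ≤ n)
    (hadj : ∀ i, m ≤ i → i < n → G.Adj (p i) (p (i + 1))) (hm : p m ∈ T)
    (hN : ∀ i, m < i → i ≤ n → p i ∉ Nbhd G T) : p n ∈ T := by
  induction n, hmn using Nat.le_induction with
  | base => exact hm
  | succ k hk ih =>
    refine mem_of_adj (ih (fun i hi hi' => hadj i hi (by omega))
      fun i hi hi' => hN i hi (by omega)) (hadj k hk (by omega)) (hN _ (by omega) le_rfl)

/-- If every two neighbours of every vertex are split, no nontrivial path has only its endvertices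
in a separator. -/
lemma no_path_between (h : WingSystem G Wg)
    (hall : ∀ x a b, G.Adj x a → G.Adj x b → a ≠ b → Splits G Wg x a b) (n : ℕ) :
    ∀ (p : ℕ → V) (C : Set V), Wg C → 2 ≤ n → (∀ i < n, G.Adj (p i) (p (i + 1))) →
      (∀ i, i + 2 ≤ n → p i ≠ p (i + 2)) → p 0 ∈ Nbhd G C → p n ∈ Nbhd G C → False := by
  classical
  induction n using Nat.strong_induction_on with
  | _ n ih =>
    intro p C hC hn hadj hne h0 hpn
    have hsp := hall (p 1) (p 0) (p 2) (hadj 0 (by omega)).symm (hadj 1 (by omega)) (hne 0 hn)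
    obtain ⟨A, B, hA, hB, hAB, hN, h1, h0A, h2B⟩ := hsp
    by_cases hex : ∃ j, 2 < j ∧ j ≤ n ∧ p j ∈ Nbhd G A
    · obtain ⟨j, hj, hjn, hjA⟩ := hex
      refine ih (j - 1) (by omega) (fun i => p (i + 1)) A hA (by omega)
        (fun i hi => hadj _ (by omega)) (fun i hi => hne _ (by omega)) h1 ?_
      rwa [show j - 1 + 1 = j by omega]
    · push Not at hex
      have hnB : p n ∈ B := path_induction hn
        (fun i _ hi => hadj i hi) h2B fun i hi hin => hN ▸ hex i hi hin
      exact Splits.notMem h ⟨A, B, hA, hB, hAB, hN, h1, h0A, hnB⟩ hC h0 hpn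

theorem isAcyclic_of_splits (h : WingSystem G Wg)
    (hall : ∀ x a b, G.Adj x a → G.Adj x b → a ≠ b → Splits G Wg x a b) : G.IsAcyclic := by
  intro v c hc
  have hlen := hc.three_le_length
  set n := c.length with hn
  set p := c.getVert with hp
  have hadj : ∀ i < n, G.Adj (p i) (p (i + 1)) := fun i hi => c.adj_getVert_succ hi
  have hinj : ∀ i j, 1 ≤ i → i ≤ n → 1 ≤ j → j ≤ n → p i = p j → i = j :=
    fun i j hi hi' hj hj' hij => hc.getVert_injOn ⟨hi, hi'⟩ ⟨hj, hj'⟩ hij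
  have h0n : p 0 = p n := by simp [hp, hn]
  have hback : G.Adj (p 0) (p (n - 1)) := by
    have := hadj (n - 1) (by omega)
    rw [show n - 1 + 1 = n by omega] at this
    exact h0n ▸ this.symm
  obtain ⟨A, B, hA, hB, hAB, hN, h0, h1A, hnB⟩ := hall (p 0) (p 1) (p (n - 1)) (hadj 0 (by omega))
    hback fun he => by have := hinj 1 (n - 1) le_rfl (by omega) (by omega) (by omega) he; omega
  have hex : ∃ j, 2 ≤ j ∧ j < n ∧ p j ∈ Nbhd G A := by
    by_contra hno
    push Not at hno
    have := path_induction (show 1 ≤ n - 1 by omega)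
      (fun i _ hi => hadj i (by omega)) h1A fun i hi hi' => hno i hi (by omega)
    exact Set.disjoint_left.1 (h.disjoint_of_ne hA hB hN hAB) this hnB
  obtain ⟨j, hj, hjn, hjA⟩ := hex
  refine no_path_between h hall j p A hA hj (fun i hi => hadj i (by omega)) (fun i hi he => ?_)
    h0 hjA
  by_cases hi0 : i = 0
  · subst hi0
    have := hinj n 2 (by omega) le_rfl (by omega) (by omega) (h0n ▸ he)
    omega
  · have := hinj i (i + 2) (by omega) (by omega) (by omega) (by omega) he
    omega

end Acyclic

/-- A C-homogeneous digraph with a wing system in which every separator has at least three wings,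
directed paths of length two and pairs of out-neighbours are split by a separator, and pairs of
in-neighbours are not. -/
structure ThreeWings (G : SimpleGraph V) (Wg : Set V → Prop) (E : V → V → Prop) : Prop extends
    WingSystem G Wg, IsCHomGraph G E where
  three : ∀ {C}, Wg C → ∃ A B, Wg A ∧ Wg B ∧ A ≠ C ∧ B ≠ C ∧ A ≠ B ∧ Nbhd G A = Nbhd G C ∧
    Nbhd G B = Nbhd G C
  inOut : ∀ {u y a}, E u y → E y a → Splits G Wg y u a
  outOut : ∀ {y a b}, E y a → E y b → a ≠ b → Splits G Wg y a b
  inIn : ∀ {y a b}, E a y → E b y → a ≠ b → ¬ Splits G Wg y a b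
  exists_inIn : ∀ y, ∃ a b, E a y ∧ E b y ∧ a ≠ b
  exists_out : ∀ y, ∃ a, E y a

/-- Three distinct wings of a separator through `y` such that all neighbours of `y` in two of them
are out-neighbours. -/
structure Fork (G : SimpleGraph V) (Wg : Set V → Prop) (E : V → V → Prop) (W C D : Set V)
    (y : V) : Prop where
  wing_base : Wg W
  wing_left : Wg C
  wing_right : Wg D
  base_ne_left : W ≠ C
  base_ne_right : W ≠ D
  left_ne_right : C ≠ D
  nbhd_base : Nbhd G W = Nbhd G C
  nbhd_right : Nbhd G D = Nbhd G C
  mem : y ∈ Nbhd G C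
  out_left : ∀ b ∈ C, G.Adj y b → E y b
  out_right : ∀ b ∈ D, G.Adj y b → E y b

lemma Fork.symm {Wg : Set V → Prop} {E : V → V → Prop} {W C D : Set V} {y : V}
    (f : Fork G Wg E W C D y) : Fork G Wg E W D C y :=
  ⟨f.wing_base, f.wing_right, f.wing_left, f.base_ne_right, f.base_ne_left, f.left_ne_right.symm,
    f.nbhd_base.trans f.nbhd_right.symm, f.nbhd_right.symm, f.nbhd_right ▸ f.mem, f.out_right,
    f.out_left⟩

namespace ThreeWings

variable {Wg : Set V → Prop} {E : V → V → Prop} (k : ThreeWings G Wg E)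
  {W C D : Set V} {y t c d : V}

include k

lemma not_adj_of_ne (hC : Wg C) (hD : Wg D) (hN : Nbhd G C = Nbhd G D) (hne : C ≠ D)
    (hc : c ∈ C) (hd : d ∈ D) : ¬ G.Adj c d := fun hcd => by
  rcases mem_or_mem_nbhd hc hcd with h | h
  · exact Set.disjoint_left.1 (k.disjoint_of_ne hC hD hN hne) h hd
  · exact (hN ▸ h : d ∈ Nbhd G D).1 hd

lemma not_edge (h : ¬ G.Adj c d) : ¬ E c d ∧ ¬ E d c :=
  ⟨fun h' => h (k.adj_of h'), fun h' => h (k.adj_of' h')⟩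

lemma exists_fork (y : V) : ∃ W C D, Fork G Wg E W C D y := by
  obtain ⟨u, -, hu, -, -⟩ := k.exists_inIn y
  obtain ⟨a, ha⟩ := k.exists_out y
  obtain ⟨W, -, hW, -, -, -, hy, huW, -⟩ := k.inOut hu ha
  obtain ⟨C, D, hC, hD, hCW, hDW, hCD, hCN, hDN⟩ := k.three hW
  have out : ∀ K, Wg K → K ≠ W → Nbhd G K = Nbhd G W → ∀ b ∈ K, G.Adj y b → E y b := by
    intro K hK hKW hN b hb hyb
    refine (k.adj.1 hyb).resolve_right fun hby => k.inIn hby hu ?_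
      ⟨K, W, hK, hW, hKW, hN, hN ▸ hy, hb, huW⟩
    rintro rfl
    exact Set.disjoint_left.1 (k.disjoint_of_ne hK hW hN hKW) hb huW
  exact ⟨W, C, D, hW, hC, hD, hCW.symm, hDW.symm, hCD, hCN.symm, hDN.trans hCN.symm, hCN ▸ hy,
    out C hC hCW hCN, out D hD hDW hDN⟩

/-- No automorphism swaps `c` and `d` while fixing other vertices of their wings. -/
lemma swap_absurd (hC : Wg C) (hD : Wg D) (hCD : C ≠ D) (hN : Nbhd G C = Nbhd G D) {F : Set V}
    (hF : F.Finite) (hc : c ∈ C) (hd : d ∈ D) (hcF : c ∉ F) (hdF : d ∉ F)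
    {c₁ d₁ : V} (hc₁ : c₁ ∈ C) (hc₁F : c₁ ∈ F) (hd₁ : d₁ ∈ D) (hd₁F : d₁ ∈ F)
    (hconn : ConnectedSet G (insert c (insert d F)))
    (hE : ∀ f ∈ F, (E f c ↔ E f d) ∧ (E c f ↔ E d f)) : False := by
  classical
  have hdis := k.disjoint_of_ne hC hD hN hCD
  have hcd : c ≠ d := fun he => Set.disjoint_left.1 hdis hc (he ▸ hd)
  have hEcd := k.not_edge (k.not_adj_of_ne hC hD hN hCD hc hd)
  have hfix : ∀ f ∈ F, Equiv.swap c d f = f := fun f hf =>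
    Equiv.swap_apply_of_ne_of_ne (fun h => hcF (h ▸ hf)) (fun h => hdF (h ▸ hf))
  obtain ⟨ψ, -, hψ⟩ := k.hom _ (Equiv.swap c d) ((hF.insert d).insert c) hconn
    (Equiv.injective _).injOn (by
      rintro a (rfl | rfl | ha) b (rfl | rfl | hb)
      · simp [k.irrefl]
      · simp [hEcd]
      · simp [hfix b hb, (hE b hb).2]
      · simp [hEcd]
      · simp [k.irrefl]
      · simp [hfix b hb, (hE b hb).2]
      · simp [hfix a ha, (hE a ha).1]
      · simp [hfix a ha, (hE a ha).1]
      · simp [hfix a ha, hfix b hb])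
  have hψc : ψ c = d := by simpa using hψ c (by simp)
  have hψd : ψ d = c := by simpa using hψ d (by simp)
  have hψc₁ : ψ c₁ = c₁ := by rw [hψ c₁ (by simp [hc₁F]), hfix c₁ hc₁F]
  have hψd₁ : ψ d₁ = d₁ := by rw [hψ d₁ (by simp [hd₁F]), hfix d₁ hd₁F]
  have hψC := k.aut ψ hC
  have hψD := k.aut ψ hD
  have hψN : Nbhd G (ψ '' C) = Nbhd G (ψ '' D) := by rw [nbhd_image, nbhd_image, hN]
  have hψdis := k.disjoint_of_ne hψC hψD hψN (ψ.injective.image_injective.ne hCD)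
  have m1 : c₁ ∈ ψ '' C := ⟨c₁, hc₁, hψc₁⟩
  have m2 : d₁ ∈ ψ '' D := ⟨d₁, hd₁, hψd₁⟩
  have m3 : d ∈ ψ '' C := ⟨c, hc, hψc⟩
  have m4 : c ∈ ψ '' D := ⟨d, hd, hψd⟩
  have s1 : Nbhd G (ψ '' C) ⊆ C ∪ Nbhd G C := (k.nest hC hψC).resolve_right fun hdj =>
    Set.disjoint_left.1 hψdis ((k.conn hC).subset_of_disjoint hdj.symm hc₁ m1 hc) m4
  have s2 : Nbhd G (ψ '' C) ⊆ D ∪ Nbhd G D := (k.nest hD hψC).resolve_right fun hdj =>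
    Set.disjoint_left.1 hψdis ((k.conn hD).subset_of_disjoint hdj.symm hd m3 hd₁) m2
  have hNN : Nbhd G (ψ '' C) = Nbhd G C := by
    refine k.nbhd_eq_of_subset hψC hC fun x hx => ?_
    rcases s1 hx with h1 | h1
    · rcases s2 hx with h2 | h2
      · exact absurd h2 (Set.disjoint_left.1 hdis h1)
      · exact hN ▸ h2
    · exact h1
  exact hCD ((k.eq_of_mem hψC hC hNN m1 hc₁).symm.trans
    (k.eq_of_mem hψC hD (hNN.trans hN) m3 hd))

lemma thin_absurd (hC : Wg C) (hy : y ∈ Nbhd G C) (ht : t ∈ Nbhd G C) (hyt : y ≠ t) (hc : c ∈ C)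
    (hyc : E y c) (htc : E t c) (hthin : ∀ b ∈ C, G.Adj y b → b = c) : False := by
  obtain ⟨ψ, -, hψc, hψy, hψt⟩ := k.exists_map_cherry (k.adj_of' hyc) (k.adj_of' htc) hyt
    (k.adj_of' htc) (k.adj_of' hyc) hyt.symm (iff_of_false (k.asymm hyc) (k.asymm htc))
    (iff_of_false (k.asymm htc) (k.asymm hyc))
  have hψC := k.aut ψ hC
  have hcψ : c ∈ ψ '' C := ⟨c, hc, hψc⟩
  have htψ : t ∈ Nbhd G (ψ '' C) := by rw [nbhd_image]; exact ⟨y, hy, hψy⟩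
  have hyψ : y ∈ Nbhd G (ψ '' C) := by rw [nbhd_image]; exact ⟨t, ht, hψt⟩
  have hthinψ : ∀ b ∈ ψ '' C, G.Adj t b → b = c := by
    rintro _ ⟨b, hb, rfl⟩ htb
    rw [← hψy, ψ.map_adj_iff] at htb
    rw [hthin b hb htb, hψc]
  by_cases hdj : Disjoint (Nbhd G (ψ '' C)) C
  · have hsub := (k.conn hC).subset_of_disjoint hdj.symm hc hcψ
    exact k.thin hC hc hy ht hyt hthin fun b hb => hthinψ b (hsub hb)
  obtain ⟨x, hxψ, hxC⟩ := Set.not_disjoint_iff.1 hdj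
  rcases k.nest hψC hC with hn | hn
  · obtain ⟨D, hD, hDne, hDN⟩ := k.other hψC
    have hDC := k.opposite_subset hψC hxψ hxC hn hD hDN hDne
    obtain ⟨b, hb, hyb⟩ := exists_adj_of_mem_nbhd (hDN ▸ hyψ : y ∈ Nbhd G D)
    have hbc := hthin b (hDC hb) hyb
    exact Set.disjoint_left.1 (k.disjoint_of_ne hD hψC hDN hDne) hb (hbc ▸ hcψ)
  · have hsub := (k.conn hψC).subset_of_disjoint hn.symm hcψ hc
    exact k.thin hψC hcψ hyψ htψ hyt (fun b hb => hthin b (hsub hb)) hthinψ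

lemma thin_absurd' (hC : Wg C) (hy : y ∈ Nbhd G C) (ht : t ∈ Nbhd G C) (hyt : y ≠ t) (hc : c ∈ C)
    (hyc : E y c) (htc : G.Adj t c) (hthin : ∀ b ∈ C, G.Adj y b → b = c) : False := by
  rcases k.adj.1 htc with h | h
  · exact k.thin_absurd hC hy ht hyt hc hyc h hthin
  · exact (k.inOut hyc h).notMem k.toWingSystem hC hy ht

lemma fork_absurd (f : Fork G Wg E W C D y) (hc : c ∈ C) (hd : d ∈ D) (hyc : E y c) (hyd : E y d)
    {t₁ t₂ c₁ d₁ : V} (ht₁ : t₁ ∈ Nbhd G C) (ht₂ : t₂ ∈ Nbhd G C)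
    (ht₁' : t₁ = y ∨ ¬ G.Adj t₁ c ∧ ¬ G.Adj t₁ d) (ht₂' : t₂ = y ∨ ¬ G.Adj t₂ c ∧ ¬ G.Adj t₂ d)
    (hc₁ : c₁ ∈ C) (htc₁ : G.Adj t₁ c₁) (hc₁c : c₁ ≠ c) (hcc₁ : ¬ G.Adj c₁ c)
    (hd₁ : d₁ ∈ D) (htd₁ : G.Adj t₂ d₁) (hd₁d : d₁ ≠ d) (hdd₁ : ¬ G.Adj d₁ d) : False := by
  have hbase : ∀ s ∈ Nbhd G C, ∃ w ∈ W, G.Adj s w := fun s hs =>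
    exists_adj_of_mem_nbhd (f.nbhd_base ▸ hs)
  obtain ⟨w, hw, hyw⟩ := hbase y f.mem
  obtain ⟨w₁, hw₁, htw₁⟩ := hbase t₁ ht₁
  obtain ⟨w₂, hw₂, htw₂⟩ := hbase t₂ ht₂
  obtain ⟨R, hRW, hRf, hR, hwR, hw₁R, hw₂R⟩ := (k.conn f.wing_base).exists_finite_triple hw hw₁ hw₂
  have hWC : ∀ r ∈ R, ∀ z ∈ C, ¬ G.Adj r z := fun r hr z hz =>
    k.not_adj_of_ne f.wing_base f.wing_left f.nbhd_base f.base_ne_left (hRW hr) hz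
  have hWD : ∀ r ∈ R, ∀ z ∈ D, ¬ G.Adj r z := fun r hr z hz =>
    k.not_adj_of_ne f.wing_base f.wing_right (f.nbhd_base.trans f.nbhd_right.symm)
      f.base_ne_right (hRW hr) hz
  have hCD : ∀ r ∈ C, ∀ z ∈ D, ¬ G.Adj r z := fun r hr z hz =>
    k.not_adj_of_ne f.wing_left f.wing_right f.nbhd_right.symm f.left_ne_right hr hz
  have hdWC := Set.disjoint_left.1
    (k.disjoint_of_ne f.wing_base f.wing_left f.nbhd_base f.base_ne_left)
  have hdWD := Set.disjoint_left.1 (k.disjoint_of_ne f.wing_base f.wing_right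
    (f.nbhd_base.trans f.nbhd_right.symm) f.base_ne_right)
  have hdCD := Set.disjoint_left.1
    (k.disjoint_of_ne f.wing_left f.wing_right f.nbhd_right.symm f.left_ne_right)
  have hSC : ∀ s ∈ Nbhd G C, s ≠ c := fun s hs he => hs.1 (he ▸ hc)
  have hSD : ∀ s ∈ Nbhd G C, s ≠ d := fun s hs he =>
    (f.nbhd_right ▸ hs : s ∈ Nbhd G D).1 (he ▸ hd)
  have non : ∀ v, ¬ G.Adj v c → ¬ G.Adj v d → (E v c ↔ E v d) ∧ (E c v ↔ E d v) := by
    intro v h1 h2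
    simp [k.not_edge h1, k.not_edge h2]
  have hyE : (E y c ↔ E y d) ∧ (E c y ↔ E d y) := by simp [hyc, hyd, k.asymm hyc, k.asymm hyd]
  refine k.swap_absurd f.wing_left f.wing_right f.left_ne_right f.nbhd_right.symm
    (F := insert d₁ (insert c₁ (insert t₂ (insert t₁ (insert y R)))))
    (((((hRf.insert _).insert _).insert _).insert _).insert _) hc hd ?_ ?_ hc₁ (by simp) hd₁
    (by simp) ?_ ?_
  · rintro (he | he | he | he | he | he)
    · exact hdCD hc (he ▸ hd₁)
    · exact hc₁c he.symm
    · exact hSC _ ht₂ he.symm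
    · exact hSC _ ht₁ he.symm
    · exact hSC _ f.mem he.symm
    · exact hdWC (hRW he) hc
  · rintro (he | he | he | he | he | he)
    · exact hd₁d he.symm
    · exact hdCD hc₁ (he ▸ hd)
    · exact hSD _ ht₂ he.symm
    · exact hSD _ ht₁ he.symm
    · exact hSD _ f.mem he.symm
    · exact hdWD (hRW he) hd
  · refine ConnectedSet.insert_adj (x := y) (ConnectedSet.insert_adj (x := y) ?_ (by simp)
      (k.adj_of hyd)) (by simp) (k.adj_of hyc)
    refine ConnectedSet.insert_adj (x := t₂) (ConnectedSet.insert_adj (x := t₁) ?_ (by simp) htc₁)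
      (by simp) htd₁
    refine ConnectedSet.insert_adj (x := w₂) (ConnectedSet.insert_adj (x := w₁)
      (ConnectedSet.insert_adj (x := w) hR hwR hyw.symm) (by simp [hw₁R]) htw₁.symm)
      (by simp [hw₂R]) htw₂.symm
  · rintro v (rfl | rfl | rfl | rfl | rfl | hv)
    · exact non _ (fun h => hCD c hc _ hd₁ h.symm) hdd₁
    · exact non _ hcc₁ (hCD _ hc₁ d hd)
    · rcases ht₂' with rfl | h
      · exact hyE
      · exact non _ h.1 h.2
    · rcases ht₁' with rfl | h
      · exact hyE
      · exact non _ h.1 h.2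
    · exact hyE
    · exact non _ (hWC v hv c hc) (hWD v hv d hd)

lemma not_adj_of_common (ha : G.Adj y c) (hb : G.Adj y d) : ¬ G.Adj c d :=
  k.triangleFree ha.symm hb

lemma fork_thin (f : Fork G Wg E W C D y) :
    (∀ a ∈ C, ∀ b ∈ C, G.Adj y a → G.Adj y b → a = b) ∨
      ∀ a ∈ D, ∀ b ∈ D, G.Adj y a → G.Adj y b → a = b := by
  by_contra hno
  push Not at hno
  obtain ⟨⟨c, hc, c₁, hc₁, hyc, hyc₁, hcc₁⟩, d, hd, d₁, hd₁, hyd, hyd₁, hdd₁⟩ := hno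
  exact k.fork_absurd f hc hd (f.out_left c hc hyc) (f.out_right d hd hyd) f.mem f.mem
    (Or.inl rfl) (Or.inl rfl) hc₁ hyc₁ hcc₁.symm (k.not_adj_of_common hyc₁ hyc)
    hd₁ hyd₁ hdd₁.symm (k.not_adj_of_common hyd₁ hyd)

lemma no_alternating_four_cycle {a b : V} (hya : E y a) (hyb : E y b) (hab : a ≠ b) (hta : E t a)
    (htb : E t b) : t = y := by
  by_contra hty
  obtain ⟨W, C, D, f⟩ := k.exists_fork y
  obtain ⟨c, hc, hyc⟩ := exists_adj_of_mem_nbhd f.mem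
  obtain ⟨d, hd, hyd⟩ := exists_adj_of_mem_nbhd (f.nbhd_right ▸ f.mem : y ∈ Nbhd G D)
  have hyc' := f.out_left c hc hyc
  have hyd' := f.out_right d hd hyd
  have hdis := k.disjoint_of_ne f.wing_left f.wing_right f.nbhd_right.symm f.left_ne_right
  have hcd : c ≠ d := fun he => Set.disjoint_left.1 hdis hc (he ▸ hd)
  obtain ⟨ψ, hψ, hψy, rfl, rfl⟩ := k.exists_map_cherry (k.adj_of hya) (k.adj_of hyb) hab hyc hyd hcd
    (iff_of_true hya hyc') (iff_of_true hyb hyd')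
  rw [← hψ] at hta htb
  have hne : y ≠ ψ t := fun he => hty (ψ.injective (hψy.trans he)).symm
  have htN : ψ t ∈ Nbhd G C := by
    refine (mem_or_mem_nbhd hc (k.adj_of' hta)).resolve_left fun htC => ?_
    exact k.not_adj_of_ne f.wing_left f.wing_right f.nbhd_right.symm f.left_ne_right htC hd
      (k.adj_of htb)
  rcases k.fork_thin f with hth | hth
  · exact k.thin_absurd f.wing_left f.mem htN hne hc hyc' hta fun b hb hyb => hth b hb _ hc hyb hyc
  · exact k.thin_absurd f.wing_right (f.nbhd_right ▸ f.mem) (f.nbhd_right ▸ htN) hne hd hyd' htb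
      fun b hb hyb => hth b hb _ hd hyb hyd

lemma splits_of_not_sink {v a b : V} (ha : G.Adj v a) (hb : G.Adj v b) (hab : a ≠ b)
    (hv : ¬ (E a v ∧ E b v)) : Splits G Wg v a b := by
  rcases k.adj.1 ha with ha' | ha' <;> rcases k.adj.1 hb with hb' | hb'
  · exact k.outOut ha' hb' hab
  · exact (k.inOut hb' ha').symm
  · exact k.inOut ha' hb'
  · exact absurd ⟨ha', hb'⟩ hv

lemma sink_of_four_cycle {v₀ v₁ v₂ v₃ : V} (h01 : G.Adj v₀ v₁) (h12 : G.Adj v₁ v₂)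
    (h23 : G.Adj v₂ v₃) (h30 : G.Adj v₃ v₀) (h02 : v₀ ≠ v₂) (h13 : v₁ ≠ v₃) :
    (E v₁ v₀ ∧ E v₃ v₀) ∨ (E v₀ v₁ ∧ E v₂ v₁) := by
  by_contra hno
  push Not at hno
  obtain ⟨A, B, hA, hB, hAB, hN, h0, h1A, h3B⟩ :=
    k.splits_of_not_sink h01 h30.symm h13 (fun h => hno.1 h.1 h.2)
  have h2 : v₂ ∈ Nbhd G A := (mem_or_mem_nbhd h1A h12).resolve_left fun h2A =>
    k.not_adj_of_ne hA hB hN hAB h2A h3B h23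
  exact (k.splits_of_not_sink h01.symm h12 h02 fun h => hno.2 h.1 h.2).notMem k.toWingSystem hA h0 h2

lemma no_four_cycle {v₀ v₁ v₂ v₃ : V} (h01 : G.Adj v₀ v₁) (h12 : G.Adj v₁ v₂)
    (h23 : G.Adj v₂ v₃) (h30 : G.Adj v₃ v₀) (h02 : v₀ ≠ v₂) : v₁ = v₃ := by
  by_contra h13
  rcases k.sink_of_four_cycle h01 h12 h23 h30 h02 h13 with h0 | h1
  · rcases k.sink_of_four_cycle h12 h23 h30 h01 h13 h02.symm with h1 | h2
    · exact k.asymm h0.1 h1.2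
    · exact h13 (k.no_alternating_four_cycle h0.2 h2.2 h02 h0.1 h2.1)
  · rcases k.sink_of_four_cycle h30 h01 h12 h23 (Ne.symm h13) h02 with h3 | h0
    · exact h02 (k.no_alternating_four_cycle h3.2 h1.2 (Ne.symm h13) h3.1 h1.1)
    · exact k.asymm h1.1 h0.2

end ThreeWings

namespace ThreeWings

variable {Wg : Set V → Prop} {E : V → V → Prop} (k : ThreeWings G Wg E)
  {W A C D : Set V} {y t c d : V}

include k

lemma exists_anchor_of_thin (f : Fork G Wg E W C D y)
    (hth : ∀ a ∈ C, ∀ b ∈ C, G.Adj y a → G.Adj y b → a = b) :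
    ∃ K c, Wg K ∧ y ∈ Nbhd G K ∧ c ∈ K ∧ E y c ∧ (∀ b ∈ K, G.Adj y b → b = c) ∧
      ∀ t ∈ Nbhd G K, ∀ z ∈ K, G.Adj t z → z = c ∨ G.Adj z c := by
  by_contra hno
  have bad : ∀ K c, Wg K → y ∈ Nbhd G K → c ∈ K → E y c → (∀ b ∈ K, G.Adj y b → b = c) →
      ∃ t ∈ Nbhd G K, ∃ z ∈ K, G.Adj t z ∧ z ≠ c ∧ ¬ G.Adj z c := by
    intro K c hK hy hc hyc hthin
    by_contra hno'
    push Not at hno'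
    exact hno ⟨K, c, hK, hy, hc, hyc, hthin, fun t ht z hz htz =>
      or_iff_not_imp_left.2 (hno' t ht z hz htz)⟩
  obtain ⟨c, hc, hyc⟩ := exists_adj_of_mem_nbhd f.mem
  have hyc' := f.out_left c hc hyc
  have hthC : ∀ b ∈ C, G.Adj y b → b = c := fun b hb h => hth b hb c hc h hyc
  obtain ⟨t₁, ht₁, c₁, hc₁, htc₁, hc₁c, hcc₁⟩ := bad C c f.wing_left f.mem hc hyc' hthC
  have hyt₁ : y ≠ t₁ := by
    rintro rfl
    exact hc₁c (hthC c₁ hc₁ htc₁)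
  have ht₁c : ¬ G.Adj t₁ c := fun h => k.thin_absurd' f.wing_left f.mem ht₁ hyt₁ hc hyc' h hthC
  by_cases hthD : ∀ a ∈ D, ∀ b ∈ D, G.Adj y a → G.Adj y b → a = b
  · have hyD : y ∈ Nbhd G D := f.nbhd_right ▸ f.mem
    obtain ⟨d, hd, hyd⟩ := exists_adj_of_mem_nbhd hyD
    have hyd' := f.out_right d hd hyd
    have hthD' : ∀ b ∈ D, G.Adj y b → b = d := fun b hb h => hthD b hb d hd h hyd
    obtain ⟨t₂, ht₂, d₁, hd₁, htd₁, hd₁d, hdd₁⟩ := bad D d f.wing_right hyD hd hyd' hthD'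
    have hyt₂ : y ≠ t₂ := by
      rintro rfl
      exact hd₁d (hthD' d₁ hd₁ htd₁)
    have adjC : ∀ t ∈ Nbhd G C, y ≠ t → ¬ G.Adj t c := fun t ht hyt h =>
      k.thin_absurd' f.wing_left f.mem ht hyt hc hyc' h hthC
    have adjD : ∀ t ∈ Nbhd G C, y ≠ t → ¬ G.Adj t d := fun t ht hyt h =>
      k.thin_absurd' f.wing_right hyD (f.nbhd_right ▸ ht) hyt hd hyd' h hthD'
    have ht₂' : t₂ ∈ Nbhd G C := f.nbhd_right ▸ ht₂
    exact k.fork_absurd f hc hd hyc' hyd' ht₁ ht₂' (Or.inr ⟨ht₁c, adjD t₁ ht₁ hyt₁⟩)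
      (Or.inr ⟨adjC t₂ ht₂' hyt₂, adjD t₂ ht₂' hyt₂⟩) hc₁ htc₁ hc₁c hcc₁ hd₁ htd₁ hd₁d hdd₁
  · push Not at hthD
    obtain ⟨a, ha, b, hb, hya, hyb, hab⟩ := hthD
    have key : ∀ d ∈ D, ∀ d₁ ∈ D, G.Adj y d → G.Adj y d₁ → d₁ ≠ d → ¬ G.Adj t₁ d → False :=
      fun d hd d₁ hd₁ hyd hyd₁ hne h => k.fork_absurd f hc hd hyc' (f.out_right d hd hyd) ht₁ f.mem
        (Or.inr ⟨ht₁c, h⟩) (Or.inl rfl) hc₁ htc₁ hc₁c hcc₁ hd₁ hyd₁ hne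
        (k.not_adj_of_common hyd₁ hyd)
    by_cases hta : G.Adj t₁ a
    · exact key b hb a ha hyb hya hab fun h => hab (k.no_four_cycle hya hta.symm h hyb.symm hyt₁)
    · exact key a ha b hb hya hyb hab.symm hta

/-- Some wing `C` at `y` contains exactly one neighbour `c` of `y`, and `c` dominates the
neighbours of the separator of `C` in `C`. -/
lemma exists_anchor (y : V) :
    ∃ C c, Wg C ∧ y ∈ Nbhd G C ∧ c ∈ C ∧ E y c ∧ (∀ b ∈ C, G.Adj y b → b = c) ∧
      ∀ t ∈ Nbhd G C, ∀ z ∈ C, G.Adj t z → z = c ∨ G.Adj z c := by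
  obtain ⟨W, C, D, f⟩ := k.exists_fork y
  rcases k.fork_thin f with h | h
  · exact k.exists_anchor_of_thin f h
  · exact k.exists_anchor_of_thin f.symm h

section Anchor

variable (hC : Wg C) (hy : y ∈ Nbhd G C) (hc : c ∈ C) (hyc : E y c)
  (hthin : ∀ b ∈ C, G.Adj y b → b = c)
  (hdom : ∀ t ∈ Nbhd G C, ∀ z ∈ C, G.Adj t z → z = c ∨ G.Adj z c)

include hC hy hc hyc hthin hdom

lemma anchor_absurd_in (ht : t ∈ Nbhd G C) (hyt : y ≠ t) (hd : d ∈ C) (htd : G.Adj t d)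
    (hdc : E d c) : False := by
  have hyd : y ≠ d := fun he => hy.1 (he ▸ hd)
  obtain ⟨ψ, -, hψc, hψy, hψd⟩ := k.exists_map_cherry (k.adj_of' hyc) (k.adj_of' hdc) hyd
    (k.adj_of' hdc) (k.adj_of' hyc) hyd.symm (iff_of_false (k.asymm hyc) (k.asymm hdc))
    (iff_of_false (k.asymm hdc) (k.asymm hyc))
  have hψC := k.aut ψ hC
  have hcψ : c ∈ ψ '' C := ⟨c, hc, hψc⟩
  have hdψ : d ∈ Nbhd G (ψ '' C) := by rw [nbhd_image]; exact ⟨y, hy, hψy⟩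
  have hthinψ : ∀ b ∈ ψ '' C, G.Adj d b → b = c := by
    rintro _ ⟨b, hb, rfl⟩ hdb
    rw [← hψy, ψ.map_adj_iff] at hdb
    rw [hthin b hb hdb, hψc]
  have hyψ : y ∈ ψ '' C := (mem_or_mem_nbhd hcψ (k.adj_of' hyc)).resolve_right fun h =>
    k.thin_absurd hψC hdψ h hyd.symm hcψ hdc hyc hthinψ
  have hn : Nbhd G C ⊆ ψ '' C ∪ Nbhd G (ψ '' C) := (k.nest hψC hC).resolve_right fun h =>
    Set.disjoint_left.1 h hy hyψ
  rcases hn ht with htψ | htψ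
  · exact ht.1 (hthinψ t htψ htd.symm ▸ hc)
  · rw [nbhd_image] at htψ
    obtain ⟨t₁, ht₁, rfl⟩ := htψ
    have hyt₁ : G.Adj y t₁ := by rw [← ψ.map_adj_iff, hψy]; exact htd.symm
    obtain ⟨d₁, hd₁, htd₁⟩ := exists_adj_of_mem_nbhd ht₁
    rcases hdom t₁ ht₁ d₁ hd₁ htd₁ with rfl | hdc₁
    · exact k.not_adj_of_common hyt₁ (k.adj_of hyc) htd₁
    · have := k.no_four_cycle (k.adj_of hyc) hdc₁.symm htd₁.symm hyt₁.symm
        fun he => hy.1 (he ▸ hd₁)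
      exact ht₁.1 (this ▸ hc)

lemma anchor_absurd_out (ht : t ∈ Nbhd G C) (hyt : y ≠ t) (htd : G.Adj t d)
    (hcd : E c d) : False := by
  rcases k.adj.1 htd with htd' | hdt
  · have huniq : ∀ z ∈ C, G.Adj t z → z = d := by
      intro z hz htz
      rcases hdom t ht z hz htz with rfl | hzc
      · exact (k.thin_absurd' hC hy ht hyt hc hyc htz hthin).elim
      · exact (k.no_four_cycle (k.adj_of hcd) htd.symm htz hzc fun he => ht.1 (he ▸ hc)).symm
    obtain ⟨A, B, hA, hB, hAB, hN, hcA, hyA, hdB⟩ := k.inOut hyc hcd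
    have htA : t ∈ Nbhd G A := by
      rw [hN]
      refine (mem_or_mem_nbhd hdB htd.symm).resolve_left fun htB => ?_
      have hs : Splits G Wg c y t := ⟨A, B, hA, hB, hAB, hN, hcA, hyA, htB⟩
      exact hs.notMem k.toWingSystem hC hy ht
    have hn : Nbhd G C ⊆ A ∪ Nbhd G A := (k.nest hA hC).resolve_right fun h =>
      Set.disjoint_left.1 h hy hyA
    obtain ⟨D, D', hD, hD', hDA, hDA', hDD', hDN, hDN'⟩ := k.three hA
    obtain ⟨K, hK, hKA, hKB, hKN⟩ : ∃ K, Wg K ∧ K ≠ A ∧ K ≠ B ∧ Nbhd G K = Nbhd G A := by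
      by_cases h : D = B
      · exact ⟨D', hD', hDA', fun h' => hDD' (h.trans h'.symm), hDN'⟩
      · exact ⟨D, hD, hDA, h, hDN⟩
    have hKC := k.opposite_subset hA hcA hc hn hK hKN hKA
    obtain ⟨z, hz, htz⟩ := exists_adj_of_mem_nbhd (hKN ▸ htA : t ∈ Nbhd G K)
    exact Set.disjoint_left.1 (k.disjoint_of_ne hK hB (hKN.trans hN) hKB) hz
      (huniq z (hKC hz) htz ▸ hdB)
  · obtain ⟨A, B, hA, hB, hAB, hN, hdA, hcA, htB⟩ := k.inOut hcd hdt
    rcases mem_or_mem_nbhd hcA (k.adj_of' hyc) with hyA | hyA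
    · have hs : Splits G Wg d y t := ⟨A, B, hA, hB, hAB, hN, hdA, hyA, htB⟩
      exact hs.notMem k.toWingSystem hC hy ht
    · exact (k.inOut hyc hcd).notMem k.toWingSystem hA hyA hdA

lemma nbhd_eq_of_anchor (ht : t ∈ Nbhd G C) : y = t := by
  by_contra hyt
  obtain ⟨d, hd, htd⟩ := exists_adj_of_mem_nbhd ht
  rcases hdom t ht d hd htd with rfl | hdc
  · exact k.thin_absurd' hC hy ht hyt hd hyc htd hthin
  · rcases k.adj.1 hdc with h | h
    · exact k.anchor_absurd_in hC hy hc hyc hthin hdom ht hyt hd htd h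
    · exact k.anchor_absurd_out hC hy hc hyc hthin hdom ht hyt htd h

end Anchor

lemma absurd_of_singleton (hC : Wg C) (hN : Nbhd G C = {y}) (hc : c ∈ C) (hyc : E y c)
    (hthin : ∀ b ∈ C, G.Adj y b → b = c) : False := by
  obtain ⟨t, hty, htc⟩ : ∃ t, t ≠ y ∧ E t c := by
    obtain ⟨a, b, ha, hb, hab⟩ := k.exists_inIn c
    by_cases h : a = y
    · exact ⟨b, fun h' => hab (h.trans h'.symm), hb⟩
    · exact ⟨a, h, ha⟩
  have hyC : y ∉ C := (by simp [hN] : y ∈ Nbhd G C).1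
  have htC : t ∈ C := mem_of_adj hc (k.adj_of' htc) (by simpa [hN] using hty)
  have single : ∀ v, ∃ K, Wg K ∧ Nbhd G K = {v} := by
    intro v
    obtain ⟨ψ, -, hψ⟩ := k.exists_map y v
    exact ⟨ψ '' C, k.aut ψ hC, by rw [nbhd_image, hN, Set.image_singleton, hψ]⟩
  have avoid : ∀ v w, ∃ K, Wg K ∧ Nbhd G K = {v} ∧ w ∉ K := by
    intro v w
    obtain ⟨K, hK, hKN⟩ := single v
    obtain ⟨K', hK', hne, hKN'⟩ := k.other hK
    by_cases hw : w ∈ K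
    · exact ⟨K', hK', hKN'.trans hKN,
        fun h => Set.disjoint_left.1 (k.disjoint_of_ne hK' hK hKN' hne) h hw⟩
    · exact ⟨K, hK, hKN, hw⟩
  obtain ⟨M, hM, hMN⟩ := single c
  have side : ∀ v, E v c → ∃ K, Wg K ∧ Nbhd G K = {c} ∧ v ∈ K := by
    intro v hvc
    have hne : v ≠ c := (k.adj_of hvc).ne
    obtain ⟨X, hX, hXN, hcX⟩ := avoid v c
    obtain ⟨K, hK, hKN, hXK⟩ := k.ext hM hX (by simpa [hMN] using hcX)
    obtain ⟨x, hx, hvx⟩ := exists_adj_of_mem_nbhd (by simp [hXN] : v ∈ Nbhd G X)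
    have hKc : Nbhd G K = {c} := hKN.trans hMN
    exact ⟨K, hK, hKc, mem_of_adj (hXK hx) hvx.symm (by simpa [hKc] using hne)⟩
  obtain ⟨K, hK, hKN, htK⟩ := side t htc
  obtain ⟨L, hL, hLN, hyL⟩ := side y hyc
  have hKL : K ≠ L := by
    rintro rfl
    refine hyC ((k.conn hK).2 C ⟨t, htK, htC⟩ ?_ hyL)
    intro x hxK hxC z hzK hxz
    refine mem_of_adj hxC hxz ?_
    rw [hN, Set.mem_singleton_iff]
    rintro rfl
    exact (hKN ▸ Set.mem_singleton c : c ∈ Nbhd G K).1 (hthin x hxC hxz.symm ▸ hxK)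
  exact k.inIn htc hyc hty ⟨K, L, hK, hL, hKL, hKN.trans hLN.symm, by simp [hKN], htK, hyL⟩

theorem absurd_of_vertex (y : V) : False := by
  obtain ⟨C, c, hC, hy, hc, hyc, hthin, hdom⟩ := k.exists_anchor y
  refine k.absurd_of_singleton hC (Set.eq_singleton_iff_unique_mem.2 ⟨hy, fun t ht => ?_⟩) hc hyc
    hthin
  exact (k.nbhd_eq_of_anchor hC hy hc hyc hthin hdom ht).symm

end ThreeWings

section

variable {Wg : Set V → Prop} {E : V → V → Prop}

lemma IsCHomGraph.isAcyclic_of_in (h : WingSystem G Wg) (e : IsCHomGraph G E)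
    (inOut : ∀ {u y a}, E u y → E y a → Splits G Wg y u a)
    (outOut : ∀ {y a b}, E y a → E y b → a ≠ b → Splits G Wg y a b)
    (inIn : ∀ {y a b}, E a y → E b y → a ≠ b → Splits G Wg y a b) : G.IsAcyclic := by
  refine isAcyclic_of_splits h fun x a b ha hb hab => ?_
  rcases e.adj.1 ha with ha | ha <;> rcases e.adj.1 hb with hb | hb
  · exact outOut ha hb hab
  · exact (inOut hb ha).symm
  · exact inOut ha hb
  · exact inIn ha hb hab

lemma IsCHomGraph.exists_out (e : IsCHomGraph G E) {a b : V} (hab : G.Adj a b) (y : V) :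
    ∃ z, E y z := by
  have key : ∀ a b, E a b → ∃ z, E y z := fun a b h => by
    obtain ⟨ψ, hψ, rfl⟩ := e.exists_map a y
    exact ⟨ψ b, (hψ a b).2 h⟩
  exact (e.adj.1 hab).elim (key a b) (key b a)

/-- Splitting of a pair of out-neighbours does not depend on the pair. -/
lemma IsCHomGraph.splits_out (h : WingSystem G Wg) (e : IsCHomGraph G E) {x y a b a' b' : V}
    (ha : E x a) (hb : E x b) (hab : a ≠ b) (hs : Splits G Wg x a b) (ha' : E y a') (hb' : E y b')
    (hab' : a' ≠ b') : Splits G Wg y a' b' := by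
  obtain ⟨ψ, -, rfl, rfl, rfl⟩ := e.exists_map_cherry (e.adj_of ha) (e.adj_of hb) hab
    (e.adj_of ha') (e.adj_of hb') hab' (iff_of_true ha ha') (iff_of_true hb hb')
  exact hs.map h ψ

/-- Three wings of one separator yield three wings of every separator. -/
lemma WingSystem.exists_three (h : WingSystem G Wg) {A B C D : Set V} (hA : Wg A) (hB : Wg B)
    (hD : Wg D) (hAB : A ≠ B) (hDA : D ≠ A) (hDB : D ≠ B) (hNB : Nbhd G B = Nbhd G A)
    (hND : Nbhd G D = Nbhd G A) (hC : Wg C) :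
    ∃ A B, Wg A ∧ Wg B ∧ A ≠ C ∧ B ≠ C ∧ A ≠ B ∧ Nbhd G A = Nbhd G C ∧ Nbhd G B = Nbhd G C := by
  obtain ⟨ψ, hψ⟩ := h.trans hA hC
  have hne : ∀ {X Y : Set V}, X ≠ Y → ψ '' X ≠ ψ '' Y := fun hXY =>
    ψ.injective.image_injective.ne hXY
  have nb : ∀ {X : Set V}, Nbhd G X = Nbhd G A → Nbhd G (ψ '' X) = Nbhd G C := fun hX => by
    rw [nbhd_image, hX, hψ]
  by_cases h1 : ψ '' A = C
  · exact ⟨_, _, h.aut ψ hB, h.aut ψ hD, h1 ▸ hne hAB.symm, h1 ▸ hne hDA, hne hDB.symm, nb hNB,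
      nb hND⟩
  by_cases h2 : ψ '' B = C
  · exact ⟨_, _, h.aut ψ hA, h.aut ψ hD, h1, h2 ▸ hne hDB, hne hDA.symm, nb rfl, nb hND⟩
  · exact ⟨_, _, h.aut ψ hA, h.aut ψ hB, h1, h2, hne hAB, nb rfl, nb hNB⟩

lemma threeWings (h : WingSystem G Wg) (e : IsCHomGraph G E) (hG : ¬ G.IsAcyclic)
    (three : ∀ {C}, Wg C → ∃ A B, Wg A ∧ Wg B ∧ A ≠ C ∧ B ≠ C ∧ A ≠ B ∧ Nbhd G A = Nbhd G C ∧
      Nbhd G B = Nbhd G C) {C : Set V} (hC : Wg C) {x p q : V} (hp : E x p) (hq : E x q)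
    (hpq : p ≠ q) (hs : Splits G Wg x p q) : ThreeWings G Wg E := by
  have inOut : ∀ {u y a}, E u y → E y a → Splits G Wg y u a := splits_in_out h e hC
  have outOut : ∀ {y a b}, E y a → E y b → a ≠ b → Splits G Wg y a b := fun ha hb hab =>
    e.splits_out h hp hq hpq hs ha hb hab
  refine ⟨h, e, three, inOut, outOut, fun {y a b} ha hb hab hsp => ?_, fun y => ?_,
    e.exists_out (e.adj_of hp)⟩
  · exact hG (e.isAcyclic_of_in h inOut outOut fun ha' hb' hab' =>
      e.flip.splits_out h ha hb hab hsp ha' hb' hab')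
  · by_contra hno
    refine hG (e.isAcyclic_of_in h inOut outOut fun {z a b} ha hb hab => ?_)
    obtain ⟨ψ, hψ, rfl⟩ := e.exists_map z y
    exact (hno ⟨ψ a, ψ b, (hψ _ _).2 ha, (hψ _ _).2 hb, ψ.injective.ne hab⟩).elim

/-- Every separator of the wing system has at most two wings. -/
theorem at_most_two_wings (h : WingSystem G Wg) (e : IsCHomGraph G E) (hG : ¬ G.IsAcyclic)
    {A B D : Set V} (hA : Wg A) (hB : Wg B) (hD : Wg D) (hNB : Nbhd G B = Nbhd G A)
    (hND : Nbhd G D = Nbhd G A) (hAB : A ≠ B) : D = A ∨ D = B := by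
  by_contra hno
  push Not at hno
  have three : ∀ {C}, Wg C → ∃ A B, Wg A ∧ Wg B ∧ A ≠ C ∧ B ≠ C ∧ A ≠ B ∧
      Nbhd G A = Nbhd G C ∧ Nbhd G B = Nbhd G C := fun hC =>
    h.exists_three hA hB hD hAB hno.1 hno.2 hNB hND hC
  obtain ⟨y, hy⟩ := h.nbhd_nonempty hA
  obtain ⟨a, ha, hya⟩ := exists_adj_of_mem_nbhd hy
  obtain ⟨b, hb, hyb⟩ := exists_adj_of_mem_nbhd (hNB ▸ hy : y ∈ Nbhd G B)
  obtain ⟨d, hd, hyd⟩ := exists_adj_of_mem_nbhd (hND ▸ hy : y ∈ Nbhd G D)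
  have key : ∀ {P Q : Set V} {p q : V}, Wg P → Wg Q → Nbhd G P = Nbhd G A →
      Nbhd G Q = Nbhd G A → P ≠ Q → p ∈ P → q ∈ Q → ¬ (E y p ∧ E y q) ∧ ¬ (E p y ∧ E q y) := by
    intro P Q p q hP hQ hNP hNQ hPQ hp hq
    have hN := hNP.trans hNQ.symm
    have hpq : p ≠ q := fun he =>
      Set.disjoint_left.1 (h.disjoint_of_ne hP hQ hN hPQ) hp (he ▸ hq)
    have hs : Splits G Wg y p q := ⟨P, Q, hP, hQ, hPQ, hN, hNP ▸ hy, hp, hq⟩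
    exact ⟨fun hE => (threeWings h e hG three hA hE.1 hE.2 hpq hs).absurd_of_vertex y,
      fun hE => (threeWings h e.flip hG three hA hE.1 hE.2 hpq hs).absurd_of_vertex y⟩
  have k1 := key hA hB rfl hNB hAB ha hb
  have k2 := key hD hA hND rfl hno.1 hd ha
  have k3 := key hD hB hND hNB hno.2 hd hb
  have := e.adj.1 hya
  have := e.adj.1 hyb
  have := e.adj.1 hyd
  tauto

end

theorem isCBlock_iff {𝒞 : Set (Set V × Set V)} (hess : ∀ c ∈ 𝒞, IsEssential G c) {X : Set V} :
    IsCBlock 𝒞 X ↔ MaxWingBlock G (IsLeftWing 𝒞) X := by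
  simp only [IsCBlock, MaxWingBlock, blockProp_iff hess]

end CutSystem

/-- Every separator of a basic cut system of a connected C-homogeneous
triangle-free digraph with more than one end that is not a tree is contained in
exactly two blocks. -/
theorem stmt_6 {V : Type u} (E : V → V → Prop) (hD : IsDigraph E)
    (hconn : (UG E).Connected) (hhom : DigraphCHom E) (htf : ¬ HasTriangle E)
    (hnt : ¬ (UG E).IsTree) (hends : MoreThanOneEnd (UG E))
    (𝒞 : Set (Set V × Set V)) (h𝒞 : IsBasic (UG E) 𝒞)
    (S : Set V) (hS : IsSeparatorOf 𝒞 S) :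
    ∃ X Y : Set V, X ≠ Y ∧ IsCBlock 𝒞 X ∧ IsCBlock 𝒞 Y ∧ S ⊆ X ∧ S ⊆ Y ∧
      ∀ Z : Set V, IsCBlock 𝒞 Z → S ⊆ Z → Z = X ∨ Z = Y := by
  obtain ⟨c, hc, rfl⟩ := hS
  have hess := h𝒞.1.2.1
  have h := CutSystem.wingSystem hconn h𝒞
  have hac : ¬ (UG E).IsAcyclic := fun hac => hnt ⟨hconn, hac⟩
  simp only [CutSystem.isCBlock_iff hess, ← CutSystem.nbhd_leftWing (hess c hc)]
  exact h.exists_two_blocks ⟨c, hc, rfl⟩ fun A B D hA hB hD' hAN hBN hDN hAB =>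
    CutSystem.at_most_two_wings h (CutSystem.isCHomGraph hD hhom htf) hac hA hB hD'
      (hBN.trans hAN.symm) (hDN.trans hAN.symm) hAB
end

section
/- Let D be a connected C-homogeneous digraph with more than one end that contains a triangle, and let 𝒞 be a basic cut system of D. Then every 𝒞-block that contains at least one edge is complete, i.e. any two distinct vertices of the block are adjacent in the underlying graph. -/
open Set

universe u

/-- `C` is the connected wing of a cut of `𝒞` with separator `S`. -/
def IsCutComp {V : Type u} (𝒞 : Set (Set V × Set V)) (S C : Set V) : Prop :=
  ∃ c ∈ 𝒞, c.1 ∩ c.2 = S ∧ c.1 \ c.2 = C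

/-- `a` and `b` are joined by a walk avoiding `S`. -/
def JoinedOff {V : Type u} (G : SimpleGraph V) (S : Set V) (a b : V) : Prop :=
  ∃ w : G.Walk a b, ∀ v ∈ w.support, v ∉ S

/-- `S` is an inclusion-minimal set separating `a` from `b`. -/
def IsMinSep {V : Type u} (G : SimpleGraph V) (a b : V) (S : Set V) : Prop :=
  a ∉ S ∧ b ∉ S ∧ ¬ JoinedOff G S a b ∧ ∀ s ∈ S, JoinedOff G (S \ {s}) a b

section Joined

variable {V : Type u} {G : SimpleGraph V}

theorem JoinedOff.trans {S : Set V} {a b c : V} (h : JoinedOff G S a b)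
    (h' : JoinedOff G S b c) : JoinedOff G S a c := by
  obtain ⟨w, hw⟩ := h
  obtain ⟨w', hw'⟩ := h'
  refine ⟨w.append w', fun v hv => ?_⟩
  rcases (SimpleGraph.Walk.mem_support_append_iff w w').1 hv with h | h
  exacts [hw v h, hw' v h]

theorem JoinedOff.symm {S : Set V} {a b : V} (h : JoinedOff G S a b) : JoinedOff G S b a := by
  obtain ⟨w, hw⟩ := h
  exact ⟨w.reverse, fun v hv => hw v (by simpa using hv)⟩

theorem JoinedOff.mono {S T : Set V} {a b : V} (h : JoinedOff G S a b) (hT : T ⊆ S) :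
    JoinedOff G T a b := by
  obtain ⟨w, hw⟩ := h
  exact ⟨w, fun v hv hvT => hw v hv (hT hvT)⟩

theorem JoinedOff.of_adj {S : Set V} {a b : V} (h : G.Adj a b) (ha : a ∉ S) (hb : b ∉ S) :
    JoinedOff G S a b := by
  refine ⟨h.toWalk, fun v hv => ?_⟩
  have : v = a ∨ v = b := by simpa using hv
  rcases this with rfl | rfl <;> assumption

theorem JoinedOff.of_connected {S Z : Set V} {a b : V} (hZ : (G.induce Z).Connected)
    (hd : Disjoint Z S) (ha : a ∈ Z) (hb : b ∈ Z) : JoinedOff G S a b := by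
  obtain ⟨w⟩ := hZ.preconnected ⟨a, ha⟩ ⟨b, hb⟩
  have hw : ∀ v ∈ (w.map (SimpleGraph.Embedding.induce Z).toHom).support, v ∉ S := by
    intro v hv
    rw [SimpleGraph.Walk.support_map, List.mem_map] at hv
    obtain ⟨z, -, rfl⟩ := hv
    exact Set.disjoint_left.1 hd z.2
  exact ⟨_, hw⟩

/-- A walk starting in a set that can only be left through `S` stays in it if it avoids `S`. -/
theorem JoinedOff.mem_of_closed {S C : Set V} {a b : V} (h : JoinedOff G S a b)
    (hC : ∀ x ∈ C, ∀ y, G.Adj x y → y ∈ C ∨ y ∈ S) (ha : a ∈ C) : b ∈ C := by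
  obtain ⟨w, hw⟩ := h
  induction w with
  | nil => exact ha
  | cons hadj w ih =>
    refine ih ?_ fun v hv => hw v (by simp [hv])
    exact (hC _ ha _ hadj).resolve_right (hw _ (by simp))

theorem exists_isCompOf_superset {Z W : Set V} (hZ : (G.induce Z).Connected) (hZW : Z ⊆ W) :
    ∃ K, IsCompOf G K W ∧ Z ⊆ K := by
  obtain ⟨z⟩ := hZ.nonempty
  let F : Set (Set V) := {C | z.1 ∈ C ∧ C ⊆ W ∧ (G.induce C).Connected}
  have hZF : Z ∈ F := ⟨z.2, hZW, hZ⟩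
  have hconn : (G.induce (⋃₀ F)).Connected :=
    SimpleGraph.induce_sUnion_connected_of_pairwise_not_disjoint ⟨Z, hZF⟩
      (fun hs ht => ⟨z.1, hs.1, ht.1⟩) (fun hs => hs.2.2)
  have hZK : Z ⊆ ⋃₀ F := subset_sUnion_of_mem hZF
  refine ⟨⋃₀ F, ⟨⟨z.1, hZK z.2⟩, sUnion_subset fun s hs => hs.2.1, hconn, ?_⟩, hZK⟩
  intro C' h1 h2 h3
  exact (subset_sUnion_of_mem (show C' ∈ F from ⟨h1 (hZK z.2), h2, h3⟩)).antisymm h1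

/-- There are only finitely many minimal separators of bounded size between two vertices. -/
theorem finite_setOf_isMinSep (a b : V) (n : ℕ) : ∀ T : Finset V,
    {S : Set V | ↑T ⊆ S ∧ S.Finite ∧ S.ncard ≤ T.card + n ∧ IsMinSep G a b S}.Finite := by
  classical
  induction n with
  | zero =>
    intro T
    refine (Set.finite_singleton (T : Set V)).subset ?_
    rintro S ⟨h1, h2, h3, -⟩
    exact (Set.eq_of_subset_of_ncard_le h1 (by simpa using h3) h2).symm
  | succ n ih =>
    intro T
    by_cases hT : JoinedOff G (T : Set V) a b
    · obtain ⟨w, hw⟩ := hT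
      refine (Set.Finite.biUnion (List.finite_toSet w.support)
        fun v _ => ih (insert v T)).subset ?_
      rintro S ⟨h1, h2, h3, h4⟩
      have : ∃ v ∈ w.support, v ∈ S := by
        by_contra! hcon
        exact h4.2.2.1 ⟨w, hcon⟩
      obtain ⟨v, hv, hvS⟩ := this
      refine Set.mem_biUnion (show v ∈ {v | v ∈ w.support} from hv) ⟨?_, h2, ?_, h4⟩
      · rw [Finset.coe_insert]
        exact Set.insert_subset hvS h1
      · rw [Finset.card_insert_of_notMem (by simpa using hw v hv)]
        omega
    · refine (Set.finite_singleton (T : Set V)).subset ?_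
      rintro S ⟨h1, h2, h3, h4⟩
      refine Set.Subset.antisymm (fun s hs => ?_) h1
      by_contra hsT
      refine hT ((h4.2.2.2 s hs).mono fun t ht => ⟨h1 ht, ?_⟩)
      rintro rfl
      exact hsT ht

theorem JoinedOff.image (φ : G ≃g G) {S : Set V} {a b : V} (h : JoinedOff G S a b) :
    JoinedOff G (φ '' S) (φ a) (φ b) := by
  obtain ⟨w, hw⟩ := h
  refine ⟨w.map φ.toHom, fun v hv => ?_⟩
  rw [SimpleGraph.Walk.support_map, List.mem_map] at hv
  obtain ⟨z, hz, rfl⟩ := hv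
  rintro ⟨y, hy, hyz⟩
  exact hw z hz (φ.injective hyz ▸ hy)

theorem IsMinSep.image (φ : G ≃g G) {S : Set V} {a b : V} (h : IsMinSep G a b S) :
    IsMinSep G (φ a) (φ b) (φ '' S) := by
  have hinv : ∀ T : Set V, φ.symm '' (φ '' T) = T := fun T => by
    rw [← Set.image_comp]; simp
  refine ⟨?_, ?_, fun hj => h.2.2.1 ?_, ?_⟩
  · rintro ⟨y, hy, hya⟩
    exact h.1 (φ.injective hya ▸ hy)
  · rintro ⟨y, hy, hya⟩
    exact h.2.1 (φ.injective hya ▸ hy)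
  · have := hj.image φ.symm
    rw [hinv] at this
    simpa using this
  · rintro _ ⟨s, hs, rfl⟩
    have := (h.2.2.2 s hs).image φ
    rwa [Set.image_sdiff φ.injective, Set.image_singleton] at this

end Joined

section CutComp

variable {V : Type u} {G : SimpleGraph V} {𝒞 : Set (Set V × Set V)} {S S' C C' D : Set V}

theorem IsCutComp.connected (h𝒞 : IsBasic G 𝒞) (h : IsCutComp 𝒞 S C) :
    (G.induce C).Connected := by
  obtain ⟨c, hc, rfl, rfl⟩ := h
  exact (h𝒞.1.2.1 c hc).2.2.2.2.1

theorem IsCutComp.finite (h𝒞 : IsBasic G 𝒞) (h : IsCutComp 𝒞 S C) : S.Finite := by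
  obtain ⟨c, hc, rfl, rfl⟩ := h
  exact (h𝒞.1.2.1 c hc).2.1

theorem IsCutComp.disjoint (h : IsCutComp 𝒞 S C) : Disjoint C S := by
  obtain ⟨c, hc, rfl, rfl⟩ := h
  exact Set.disjoint_left.2 fun x hx hx' => hx.2 hx'.2

theorem IsCutComp.closed (h𝒞 : IsBasic G 𝒞) (h : IsCutComp 𝒞 S C) :
    ∀ x ∈ C, ∀ y, G.Adj x y → y ∈ C ∨ y ∈ S := by
  obtain ⟨c, hc, rfl, rfl⟩ := h
  intro x hx y hxy
  have := ((h𝒞.1.2.1 c hc).1.2 x y hxy).resolve_right fun h => hx.2 h.1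
  by_cases hy : y ∈ c.2
  · exact Or.inr ⟨this.2, hy⟩
  · exact Or.inl ⟨this.2, hy⟩

theorem IsCutComp.exists_adj (h𝒞 : IsBasic G 𝒞) (h : IsCutComp 𝒞 S C) {s : V} (hs : s ∈ S) :
    ∃ x ∈ C, G.Adj s x := by
  have hcl := h.closed h𝒞
  obtain ⟨c, hc, rfl, rfl⟩ := h
  by_contra! hcon
  have hess := (h𝒞.1.2.1 c hc).2.2.2.2.2 ((c.1 ∩ c.2) \ {s})
    ⟨Set.sdiff_subset, fun hsub => (hsub hs).2 rfl⟩
  unfold SeparatesWings at hess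
  push Not at hess
  obtain ⟨a, ha, b, hb, w, hw⟩ := hess
  have hj : JoinedOff G ((c.1 ∩ c.2) \ {s}) a b := ⟨w, hw⟩
  refine (hj.mem_of_closed (C := c.1 \ c.2) (fun x hx y hxy => ?_) ha).2 hb.1
  refine (hcl x hx y hxy).imp_right fun hy => ⟨hy, ?_⟩
  rintro rfl
  exact hcon x hx hxy.symm

theorem IsCutComp.ncard_eq (h𝒞 : IsBasic G 𝒞) (h : IsCutComp 𝒞 S C) (h' : IsCutComp 𝒞 S' C') :
    S.ncard = S'.ncard := by
  obtain ⟨c, hc, rfl, rfl⟩ := h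
  obtain ⟨d, hd, rfl, rfl⟩ := h'
  exact le_antisymm (not_lt.1 (h𝒞.2.1 d hd c hc)) (not_lt.1 (h𝒞.2.1 c hc d hd))

theorem IsCutComp.eq_of_subset (h𝒞 : IsBasic G 𝒞) (h : IsCutComp 𝒞 S C)
    (h' : IsCutComp 𝒞 S' C') (hs : S ⊆ S') : S = S' :=
  Set.eq_of_subset_of_ncard_le hs (h.ncard_eq h𝒞 h').ge (h'.finite h𝒞)

theorem IsCutComp.subset_of_mem (h𝒞 : IsBasic G 𝒞) (h : IsCutComp 𝒞 S C) {Z : Set V}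
    (hZ : (G.induce Z).Connected) (hd : Disjoint Z S) {x : V} (hx : x ∈ Z) (hxC : x ∈ C) :
    Z ⊆ C := fun _ hy =>
  (JoinedOff.of_connected hZ hd hx hy).mem_of_closed (h.closed h𝒞) hxC

theorem IsCutComp.disjoint_of_ne (h𝒞 : IsBasic G 𝒞) (h : IsCutComp 𝒞 S C)
    (h' : IsCutComp 𝒞 S D) (hne : C ≠ D) : Disjoint C D :=
  Set.disjoint_left.2 fun _ hx hx' => hne <|
    (h'.subset_of_mem h𝒞 (h.connected h𝒞) h.disjoint hx hx').antisymm
      (h.subset_of_mem h𝒞 (h'.connected h𝒞) h'.disjoint hx' hx)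

theorem IsCutComp.nested (h𝒞 : IsBasic G 𝒞) (h : IsCutComp 𝒞 S C) (h' : IsCutComp 𝒞 S' C') :
    S' ⊆ C ∪ S ∨ Disjoint S' C := by
  obtain ⟨c, hc, rfl, rfl⟩ := h
  obtain ⟨d, hd, rfl, rfl⟩ := h'
  obtain ⟨i, j, -, hsub⟩ := h𝒞.2.2.1 c hc d hd
  have hsub' : d.1 ∩ d.2 ⊆ pickSide c (!i) :=
    (Set.subset_union_right.trans hsub).trans Set.inter_subset_left
  cases i
  · refine Or.inr (Set.disjoint_left.2 fun x hx hx' => hx'.2 (hsub' hx))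
  · refine Or.inl fun x hx => ?_
    have hx1 : x ∈ c.1 := hsub' hx
    by_cases hx2 : x ∈ c.2
    · exact Or.inr ⟨hx1, hx2⟩
    · exact Or.inl ⟨hx1, hx2⟩

theorem IsCutComp.subset_union_of_mem (h𝒞 : IsBasic G 𝒞) (h : IsCutComp 𝒞 S C)
    (h' : IsCutComp 𝒞 S' C') {x : V} (hx : x ∈ S') (hxC : x ∈ C) : S' ⊆ C ∪ S :=
  (h.nested h𝒞 h').resolve_right fun hd => Set.disjoint_left.1 hd hx hxC

theorem isCutComp_of_isCompOf (h𝒞 : IsBasic G 𝒞) {c d : Set V × Set V} (hc : c ∈ 𝒞) (hd : d ∈ 𝒞)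
    {K : Set V} (hK : IsCompOf G K (c.2 \ c.1)) (hdK : d.1 \ d.2 ⊆ K) :
    IsCutComp 𝒞 (c.1 ∩ c.2) K := by
  have he := h𝒞.1.2.2.2.1 c hc K hK ⟨d, hd, hdK⟩
  have hN : Nbhd G K ⊆ c.1 ∩ c.2 := by
    rintro v ⟨hvK, x, hx, hxv⟩
    have hv2 := ((h𝒞.1.2.1 c hc).1.2 x v hxv).resolve_left fun h => (hK.2.1 hx).2 h.1
    refine ⟨?_, hv2.2⟩
    by_contra hv1
    refine hvK ?_
    have hconn : (G.induce (K ∪ {v})).Connected :=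
      SimpleGraph.connected_induce_union hK.2.2.1.preconnected
        (SimpleGraph.Preconnected.of_subsingleton) hx rfl hxv
    rw [← hK.2.2.2 _ Set.subset_union_left
      (Set.union_subset hK.2.1 (by rintro _ rfl; exact ⟨hv2.2, hv1⟩)) hconn]
    exact Or.inr rfl
  set e := tildeSep G (K ∪ Nbhd G K) with hedef
  have hKe : ∀ x ∈ K, x ∉ e.2 := by
    rintro x hx (h | ⟨-, u, hu, hux⟩)
    · exact h (Or.inl hx)
    · refine hu ?_
      by_cases huK : u ∈ K
      · exact Or.inl huK
      · exact Or.inr ⟨huK, x, hx, hux.symm⟩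
  have hsep : e.1 ∩ e.2 ⊆ Nbhd G K := by
    rintro x ⟨hx1 | hx1, hx2⟩
    · exact absurd hx2 (hKe x hx1)
    · exact hx1
  have heq : e.1 ∩ e.2 = c.1 ∩ c.2 :=
    IsCutComp.eq_of_subset h𝒞 ⟨e, he, rfl, rfl⟩ ⟨c, hc, rfl, rfl⟩ (hsep.trans hN)
  refine ⟨e, he, heq, Set.Subset.antisymm ?_ fun x hx => ⟨Or.inl hx, hKe x hx⟩⟩
  rintro x ⟨hx1 | hx1, hx2⟩
  · exact hx1
  · have := hN hx1
    rw [← heq] at this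
    exact absurd this.2 hx2

theorem IsCutComp.exists_ne (h𝒞 : IsBasic G 𝒞) (h : IsCutComp 𝒞 S C) :
    ∃ D, IsCutComp 𝒞 S D ∧ D ≠ C := by
  have hadj := fun {s} (hs : s ∈ S) => h.exists_adj h𝒞 hs
  obtain ⟨c, hc, rfl, rfl⟩ := h
  obtain ⟨d, hd, hdc⟩ := h𝒞.1.2.2.1 c hc
  have hsub : d.1 \ d.2 ⊆ c.2 \ c.1 := by
    refine fun x hx => ⟨hdc hx.1, fun hx1 => ?_⟩
    obtain ⟨y, hy, hxy⟩ := hadj ⟨hx1, hdc hx.1⟩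
    have := ((h𝒞.1.2.1 d hd).1.2 x y hxy).resolve_right fun h => hx.2 h.1
    exact hy.2 (hdc this.2)
  obtain ⟨K, hK, hdK⟩ := exists_isCompOf_superset (h𝒞.1.2.1 d hd).2.2.2.2.1 hsub
  refine ⟨K, isCutComp_of_isCompOf h𝒞 hc hd hK hdK, ?_⟩
  rintro rfl
  obtain ⟨x, hx⟩ := hK.1
  exact (hK.2.1 hx).2 hx.1

/-- A separator lies, up to its intersection with another one, in a component of the latter. -/
theorem IsCutComp.exists_subset_union (h𝒞 : IsBasic G 𝒞) (h : IsCutComp 𝒞 S C)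
    (h' : IsCutComp 𝒞 S' C') (hne : S ≠ S') : ∃ K, IsCutComp 𝒞 S K ∧ S' ⊆ K ∪ S := by
  by_contra! hcon
  have hmeet : ∀ K, IsCutComp 𝒞 S K → ∀ x ∈ S', x ∉ K := fun K hK x hx hxK =>
    hcon K hK (hK.subset_union_of_mem h𝒞 h' hx hxK)
  obtain ⟨t, htS, htS'⟩ := Set.not_subset.1 fun hs => hne (h.eq_of_subset h𝒞 h' hs)
  obtain ⟨s', hs', hsS⟩ := Set.not_subset.1 fun hs => hne (h'.eq_of_subset h𝒞 h hs).symm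
  obtain ⟨Z, hZ, htZ⟩ : ∃ Z, IsCutComp 𝒞 S' Z ∧ t ∉ Z := by
    by_cases ht : t ∈ C'
    · obtain ⟨D, hD, hDne⟩ := h'.exists_ne h𝒞
      exact ⟨D, hD, fun htD => Set.disjoint_left.1 (hD.disjoint_of_ne h𝒞 h' hDne) htD ht⟩
    · exact ⟨C', h', ht⟩
  have hSZ : Disjoint Z S := by
    refine ((hZ.nested h𝒞 h).resolve_left fun hs => ?_).symm
    exact (hs htS).elim htZ htS'
  obtain ⟨w, hwZ, hw⟩ := hZ.exists_adj h𝒞 hs'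
  have hwC : w ∉ C := fun hwC =>
    (h.closed h𝒞 w hwC s' hw.symm).elim (hmeet C h s' hs') hsS
  have hZC : ∀ x ∈ Z, x ∉ C := fun x hx hxC =>
    hwC (h.subset_of_mem h𝒞 (hZ.connected h𝒞) hSZ hx hxC hwZ)
  have hZconn := hZ.connected h𝒞
  obtain ⟨c, hc, rfl, rfl⟩ := h
  obtain ⟨d, hd, hdS', rfl⟩ := hZ
  have hcov : ∀ x, x ∉ c.1 → x ∈ c.2 := fun x hx =>
    (((h𝒞.1.2.1 c hc).1.1 ▸ Set.mem_univ x : x ∈ c.1 ∪ c.2)).resolve_left hx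
  have hsub : d.1 \ d.2 ⊆ c.2 \ c.1 := by
    intro x hx
    have hx1 : x ∉ c.1 := fun hx1 => by
      by_cases hx2 : x ∈ c.2
      · exact Set.disjoint_left.1 hSZ hx ⟨hx1, hx2⟩
      · exact hZC x hx ⟨hx1, hx2⟩
    exact ⟨hcov x hx1, hx1⟩
  obtain ⟨K, hK, hdK⟩ := exists_isCompOf_superset hZconn hsub
  have hKcut := isCutComp_of_isCompOf h𝒞 hc hd hK hdK
  exact (hKcut.closed h𝒞 w (hdK hwZ) s' hw.symm).elim (hmeet K hKcut s' hs') hsS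

/-- If `S'` lies beyond the component `C` of `S`, then every other component of `S` lies in
the component of `S'` that meets `S`. -/
theorem IsCutComp.subset_of_subset_union (h𝒞 : IsBasic G 𝒞) (hC : IsCutComp 𝒞 S C)
    (hD : IsCutComp 𝒞 S D) (hne : D ≠ C) (hS' : S' ⊆ C ∪ S) (h' : IsCutComp 𝒞 S' C') {t : V}
    (ht : t ∈ S) (htC' : t ∈ C') : D ⊆ C' := by
  have hDS' : Disjoint D S' := Set.disjoint_left.2 fun x hxD hx =>
    (hS' hx).elim (Set.disjoint_left.1 (hD.disjoint_of_ne h𝒞 hC hne) hxD)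
      (Set.disjoint_left.1 hD.disjoint hxD)
  obtain ⟨y, hyD, hty⟩ := hD.exists_adj h𝒞 ht
  refine h'.subset_of_mem h𝒞 (hD.connected h𝒞) hDS' hyD ?_
  exact (h'.closed h𝒞 t htC' y hty).resolve_right (Set.disjoint_left.1 hDS' hyD)

theorem IsCutComp.not_adj (h𝒞 : IsBasic G 𝒞) (hC : IsCutComp 𝒞 S C) (hD : IsCutComp 𝒞 S D)
    (hne : C ≠ D) {a b : V} (ha : a ∈ C) (hb : b ∈ D) : a ≠ b ∧ ¬ G.Adj a b := by
  have hd := Set.disjoint_left.1 (hC.disjoint_of_ne h𝒞 hD hne)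
  refine ⟨fun h => hd ha (h ▸ hb), fun h => ?_⟩
  exact (hC.closed h𝒞 a ha b h).elim (fun h => hd h hb) (Set.disjoint_left.1 hD.disjoint hb)

theorem IsCutComp.isMinSep (h𝒞 : IsBasic G 𝒞) (hC : IsCutComp 𝒞 S C) (hD : IsCutComp 𝒞 S D)
    (hne : C ≠ D) {a b : V} (ha : a ∈ C) (hb : b ∈ D) : IsMinSep G a b S := by
  refine ⟨Set.disjoint_left.1 hC.disjoint ha, Set.disjoint_left.1 hD.disjoint hb, fun hj => ?_,
    fun s hs => ?_⟩
  · exact Set.disjoint_left.1 (hC.disjoint_of_ne h𝒞 hD hne)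
      (hj.mem_of_closed (hC.closed h𝒞) ha) hb
  · obtain ⟨x, hx, hsx⟩ := hC.exists_adj h𝒞 hs
    obtain ⟨y, hy, hsy⟩ := hD.exists_adj h𝒞 hs
    have hdC : Disjoint C (S \ {s}) := hC.disjoint.mono_right Set.sdiff_subset
    have hdD : Disjoint D (S \ {s}) := hD.disjoint.mono_right Set.sdiff_subset
    have hs' : s ∉ S \ {s} := fun h => h.2 rfl
    exact (((JoinedOff.of_connected (hC.connected h𝒞) hdC ha hx).trans
      (JoinedOff.of_adj hsx.symm (Set.disjoint_left.1 hdC hx) hs')).trans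
      (JoinedOff.of_adj hsy hs' (Set.disjoint_left.1 hdD hy))).trans
      (JoinedOff.of_connected (hD.connected h𝒞) hdD hy hb)

theorem IsCutComp.image (h𝒞 : IsBasic G 𝒞) (φ : G ≃g G) (h : IsCutComp 𝒞 S C) :
    IsCutComp 𝒞 (φ '' S) (φ '' C) := by
  obtain ⟨c, hc, rfl, rfl⟩ := h
  exact ⟨_, h𝒞.2.2.2.1 φ c hc, (Set.image_inter φ.injective).symm,
    (Set.image_sdiff φ.injective _ _).symm⟩

/-- The separators of `𝒞` that are minimal separators of `a` and `b`. -/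
def sepsBetween (G : SimpleGraph V) (𝒞 : Set (Set V × Set V)) (a b : V) : Set (Set V) :=
  {S | (∃ C, IsCutComp 𝒞 S C) ∧ IsMinSep G a b S}

theorem finite_sepsBetween (h𝒞 : IsBasic G 𝒞) (a b : V) : (sepsBetween G 𝒞 a b).Finite := by
  obtain ⟨c, hc⟩ := h𝒞.1.1
  refine (finite_setOf_isMinSep (G := G) a b (c.1 ∩ c.2).ncard ∅).subset ?_
  rintro S ⟨⟨C, hC⟩, hS⟩
  exact ⟨by simp, hC.finite h𝒞, by simpa using (hC.ncard_eq h𝒞 ⟨c, hc, rfl, rfl⟩).le, hS⟩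

theorem ncard_sepsBetween_le (h𝒞 : IsBasic G 𝒞) (φ : G ≃g G) (a b : V) :
    (sepsBetween G 𝒞 a b).ncard ≤ (sepsBetween G 𝒞 (φ a) (φ b)).ncard := by
  refine Set.ncard_le_ncard_of_injOn (fun S => φ '' S) ?_
    (Set.image_injective.2 φ.injective).injOn (finite_sepsBetween h𝒞 _ _)
  rintro S ⟨⟨C, hC⟩, hS⟩
  exact ⟨⟨_, hC.image h𝒞 φ⟩, hS.image φ⟩

/-- If an edge from `s ∈ S` into `C` lies in a separator, then `s` has a neighbour further away
from the other side of `S`. -/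
theorem IsCutComp.exists_ncard_sepsBetween_lt (h𝒞 : IsBasic G 𝒞) (hC : IsCutComp 𝒞 S C)
    (hD : IsCutComp 𝒞 S D) (hne : D ≠ C) {s a b : V} (ha : a ∈ C) (hb : b ∈ D)
    {S₁ C₀ : Set V} (h₁ : IsCutComp 𝒞 S₁ C₀) (hs₁ : s ∈ S₁) (ha₁ : a ∈ S₁) :
    ∃ C₁ D₁ a₁, IsCutComp 𝒞 S₁ C₁ ∧ IsCutComp 𝒞 S₁ D₁ ∧ D₁ ≠ C₁ ∧ G.Adj s a₁ ∧ a₁ ∈ C₁ ∧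
      b ∈ D₁ ∧ (sepsBetween G 𝒞 a b).ncard < (sepsBetween G 𝒞 a₁ b).ncard := by
  have hSne : S ≠ S₁ := by
    rintro rfl
    exact Set.disjoint_left.1 hC.disjoint ha ha₁
  have hS₁ := hC.subset_union_of_mem h𝒞 h₁ ha₁ ha
  obtain ⟨D₁, hD₁, hSD₁⟩ := h₁.exists_subset_union h𝒞 hC hSne.symm
  obtain ⟨t, htS, htS₁⟩ := Set.not_subset.1 fun hsub => hSne (hC.eq_of_subset h𝒞 h₁ hsub)
  have hb₁ : b ∈ D₁ :=
    hC.subset_of_subset_union h𝒞 hD hne hS₁ hD₁ htS ((hSD₁ htS).resolve_right htS₁) hb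
  obtain ⟨C₁, hC₁, hne₁⟩ := hD₁.exists_ne h𝒞
  obtain ⟨a₁, ha₁C, hsa₁⟩ := hC₁.exists_adj h𝒞 hs₁
  refine ⟨C₁, D₁, a₁, hC₁, hD₁, hne₁.symm, hsa₁, ha₁C, hb₁, ?_⟩
  refine Set.ncard_lt_ncard ⟨?_, fun hsub => ?_⟩ (finite_sepsBetween h𝒞 _ _)
  · rintro T ⟨⟨K, hK⟩, hT⟩
    have hTne : S₁ ≠ T := by
      rintro rfl
      exact hT.1 ha₁
    obtain ⟨F, hF, hS₁F⟩ := hK.exists_subset_union h𝒞 h₁ hTne.symm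
    obtain ⟨M, hM, hTM⟩ := h₁.exists_subset_union h𝒞 hK hTne
    have haF : a ∈ F := (hS₁F ha₁).resolve_right hT.1
    have hMD : M = D₁ := by
      by_contra hMD
      have := hM.subset_of_subset_union h𝒞 hD₁ (Ne.symm hMD) hTM hF ha₁ haF hb₁
      exact hT.2.2.1 (JoinedOff.of_connected (hF.connected h𝒞) hF.disjoint haF this)
    subst hMD
    have ha₁F := hM.subset_of_subset_union h𝒞 hC₁ hne₁ hTM hF ha₁ haF ha₁C
    have hj := JoinedOff.of_connected (hF.connected h𝒞) hF.disjoint haF ha₁F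
    exact ⟨⟨K, hK⟩, Set.disjoint_left.1 hF.disjoint ha₁F, hT.2.1,
      fun h => hT.2.2.1 (hj.trans h),
      fun t ht => (hj.symm.mono Set.sdiff_subset).trans (hT.2.2.2 t ht)⟩
  · exact (hsub ⟨⟨_, h₁⟩, hC₁.isMinSep h𝒞 hD₁ hne₁ ha₁C hb₁⟩).2.1 ha₁

theorem BlockProp.not_separated (h𝒞 : IsBasic G 𝒞) {X : Set V} (hX : BlockProp 𝒞 X)
    (hC : IsCutComp 𝒞 S C) (hD : IsCutComp 𝒞 S D) (hne : C ≠ D) {x y : V} (hx : x ∈ X)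
    (hy : y ∈ X) (hxC : x ∈ C) (hyD : y ∈ D) : False := by
  have hyC := Set.disjoint_left.1 (hC.disjoint_of_ne h𝒞 hD hne).symm hyD
  have hyS := Set.disjoint_left.1 hD.disjoint hyD
  obtain ⟨c, hc, rfl, rfl⟩ := hC
  rcases (hX.1 c hc).1 with h | h
  · by_cases hy2 : y ∈ c.2
    · exact hyS ⟨h hy, hy2⟩
    · exact hyC ⟨h hy, hy2⟩
  · exact hxC.2 (h hx)

end CutComp

section Digraph

variable {V : Type u} {E : V → V → Prop}

/-- An automorphism of a digraph, as an automorphism of its underlying graph. -/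
def UG.iso (ψ : Equiv.Perm V) (hψ : ∀ x y, E (ψ x) (ψ y) ↔ E x y) : UG E ≃g UG E where
  toEquiv := ψ
  map_rel_iff' := by simp [UG, SimpleGraph.fromRel_adj, hψ]

/-- Two isomorphic finite paths, with isomorphic induced subdigraphs, are equivalent. -/
theorem DigraphCHom.exists_of_path (hhom : DigraphCHom E) (m : ℕ) (p q : ℕ → V)
    (hp : Set.InjOn p (Set.Iic m)) (hq : Set.InjOn q (Set.Iic m))
    (hE : ∀ i ≤ m, ∀ j ≤ m, (E (p i) (p j) ↔ E (q i) (q j)))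
    (hadj : ∀ i < m, (UG E).Adj (p i) (p (i + 1))) :
    ∃ φ : UG E ≃g UG E, (∀ x y, E (φ x) (φ y) ↔ E x y) ∧ ∀ i ≤ m, φ (p i) = q i := by
  let e₁ := Equiv.Set.imageOfInjOn p (Set.Iic m) hp
  let e₂ := Equiv.Set.imageOfInjOn q (Set.Iic m) hq
  have he₁ : ∀ i (hi : i ≤ m), e₁.symm ⟨p i, i, hi, rfl⟩ = ⟨i, hi⟩ := fun i hi => by
    rw [Equiv.symm_apply_eq]; rfl
  have hconn : ((UG E).induce (p '' Set.Iic m)).Connected := by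
    have h0 : p 0 ∈ p '' Set.Iic m := ⟨0, Nat.zero_le m, rfl⟩
    have key : ∀ i (hi : i ≤ m), ((UG E).induce (p '' Set.Iic m)).Reachable ⟨p 0, h0⟩
        ⟨p i, i, hi, rfl⟩ := by
      intro i
      induction i with
      | zero => exact fun _ => SimpleGraph.Reachable.refl _
      | succ i ih =>
        refine fun hi => (ih (by omega)).trans (SimpleGraph.Adj.reachable ?_)
        exact hadj i hi
    have : Nonempty (p '' Set.Iic m) := ⟨⟨p 0, h0⟩⟩
    refine ⟨?_⟩
    rintro ⟨_, i, hi, rfl⟩ ⟨_, j, hj, rfl⟩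
    exact (key i hi).symm.trans (key j hj)
  obtain ⟨ψ, hψ, hψe⟩ := hhom (p '' Set.Iic m) (q '' Set.Iic m) ((Set.finite_Iic m).image p)
    ((Set.finite_Iic m).image q) hconn (e₁.symm.trans e₂) (by
      rintro ⟨_, i, hi, rfl⟩ ⟨_, j, hj, rfl⟩
      simp only [Equiv.trans_apply, he₁ i hi, he₁ j hj]
      exact hE i hi j hj)
  refine ⟨UG.iso ψ hψ, hψ, fun i hi => ?_⟩
  have := hψe ⟨p i, i, hi, rfl⟩
  simp only [Equiv.trans_apply, he₁ i hi] at this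
  exact this

theorem DigraphCHom.exists_of_edge (hD : IsDigraph E) (hhom : DigraphCHom E) {x y x' y' : V}
    (h : E x y) (h' : E x' y') :
    ∃ φ : UG E ≃g UG E, (∀ x y, E (φ x) (φ y) ↔ E x y) ∧ φ x = x' ∧ φ y = y' := by
  have hne : ∀ {x y}, E x y → x ≠ y := fun h e => hD.1 _ (e ▸ h)
  have hinj : ∀ {x y}, E x y → Set.InjOn (fun n : ℕ => if n = 0 then x else y) (Set.Iic 1) := by
    intro x y h i hi j hj hij
    have hxy := hne h
    have hi : i ≤ 1 := hi
    have hj : j ≤ 1 := hj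
    interval_cases i <;> interval_cases j <;> simp [hxy, hxy.symm] at hij ⊢
  obtain ⟨φ, hφ, hφp⟩ := hhom.exists_of_path 1 (fun n => if n = 0 then x else y)
    (fun n => if n = 0 then x' else y') (hinj h) (hinj h')
    (by
      intro i hi j hj
      have := hD.1 x; have := hD.1 y; have := hD.1 x'; have := hD.1 y'
      have := hD.2 x y h; have := hD.2 x' y' h'
      interval_cases i <;> interval_cases j <;> simp_all)
    (by
      intro i hi
      interval_cases i
      simpa [UG, SimpleGraph.fromRel_adj] using ⟨hne h, Or.inl h⟩)
  exact ⟨φ, hφ, by simpa using hφp 0, by simpa using hφp 1⟩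

variable {𝒞 : Set (Set V × Set V)}

theorem UG.adj_of_edge (hD : IsDigraph E) {x y : V} (h : E x y) : (UG E).Adj x y :=
  (SimpleGraph.fromRel_adj _ _ _).2 ⟨fun e => hD.1 _ (e ▸ h), Or.inl h⟩

theorem UG.edge_or_of_adj {x y : V} (h : (UG E).Adj x y) : E x y ∨ E y x :=
  ((SimpleGraph.fromRel_adj _ _ _).1 h).2

/-- Two equally oriented induced paths `a s b` and `a' s b` have equally many separators between
their end vertices. -/
theorem ncard_sepsBetween_le_of_edge_iff (hD : IsDigraph E) (hhom : DigraphCHom E)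
    (h𝒞 : IsBasic (UG E) 𝒞) {s a a' b : V} (ha : (UG E).Adj s a) (ha' : (UG E).Adj s a')
    (hb : (UG E).Adj s b) (hab : a ≠ b ∧ ¬ (UG E).Adj a b) (hab' : a' ≠ b ∧ ¬ (UG E).Adj a' b)
    (h : E s a ↔ E s a') :
    (sepsBetween (UG E) 𝒞 a' b).ncard ≤ (sepsBetween (UG E) 𝒞 a b).ncard := by
  let f : V → ℕ → V := fun a n => if n = 0 then a else if n = 1 then s else b
  have hinj : ∀ a, (UG E).Adj s a → a ≠ b → Set.InjOn (f a) (Set.Iic 2) := by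
    intro a ha hne i hi j hj hij
    have hi : i ≤ 2 := hi
    have hj : j ≤ 2 := hj
    have := ha.ne
    have := hb.ne
    interval_cases i <;> interval_cases j <;> simp_all [f]
  have hrev : ∀ a, (UG E).Adj s a → (E a s ↔ ¬ E s a) := fun a ha =>
    ⟨hD.2 a s, (UG.edge_or_of_adj ha).resolve_left⟩
  have hno : ∀ a, a ≠ b ∧ ¬ (UG E).Adj a b → ¬ E a b ∧ ¬ E b a := fun a hab =>
    ⟨fun h => hab.2 (UG.adj_of_edge hD h), fun h => hab.2 (UG.adj_of_edge hD h).symm⟩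
  obtain ⟨φ, -, hφp⟩ := hhom.exists_of_path 2 (f a') (f a) (hinj a' ha' hab'.1)
    (hinj a ha hab.1)
    (by
      intro i hi j hj
      have := hno a hab; have := hno a' hab'
      have := hrev a ha; have := hrev a' ha'
      have := hD.1
      interval_cases i <;> interval_cases j <;> simp_all [f])
    (by
      intro i hi
      interval_cases i
      · simpa [f] using ha'.symm
      · simpa [f] using hb)
  have h0 : φ a' = a := by simpa [f] using hφp 0
  have h2 : φ b = b := by simpa [f] using hφp 2
  have := ncard_sepsBetween_le h𝒞 φ a' b
  rwa [h0, h2] at this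

theorem not_adj_of_mem_separator (hD : IsDigraph E) (hhom : DigraphCHom E)
    (h𝒞 : IsBasic (UG E) 𝒞) {S C : Set V} (hC : IsCutComp 𝒞 S C) {u v : V} (hu : u ∈ S)
    (hv : v ∈ S) : ¬ (UG E).Adj u v := by
  intro huv
  have hedge : ∀ x y, E x y → ∃ S₁ C₁, IsCutComp 𝒞 S₁ C₁ ∧ x ∈ S₁ ∧ y ∈ S₁ := by
    intro x y hxy
    rcases UG.edge_or_of_adj huv with h | h
    · obtain ⟨φ, -, rfl, rfl⟩ := hhom.exists_of_edge hD h hxy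
      exact ⟨_, _, hC.image h𝒞 φ, ⟨u, hu, rfl⟩, ⟨v, hv, rfl⟩⟩
    · obtain ⟨φ, -, rfl, rfl⟩ := hhom.exists_of_edge hD h hxy
      exact ⟨_, _, hC.image h𝒞 φ, ⟨v, hv, rfl⟩, ⟨u, hu, rfl⟩⟩
  have hadj : ∀ x y, (UG E).Adj x y → ∃ S₁ C₁, IsCutComp 𝒞 S₁ C₁ ∧ x ∈ S₁ ∧ y ∈ S₁ := by
    intro x y hxy
    rcases UG.edge_or_of_adj hxy with h | h
    · exact hedge x y h
    · obtain ⟨S₁, C₁, h1, h2, h3⟩ := hedge y x h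
      exact ⟨S₁, C₁, h1, h3, h2⟩
  obtain ⟨D, hDS, hne⟩ := hC.exists_ne h𝒞
  obtain ⟨a, haC, hua⟩ := hC.exists_adj h𝒞 hu
  obtain ⟨b, hbD, hub⟩ := hDS.exists_adj h𝒞 hu
  obtain ⟨S₁, C₁', h₁, hu₁, ha₁⟩ := hadj u a hua
  obtain ⟨C₁, D₁, a₁, hC₁, hD₁, hne₁, hua₁, ha₁C, hb₁, hlt₁⟩ :=
    hC.exists_ncard_sepsBetween_lt h𝒞 hDS hne haC hbD h₁ hu₁ ha₁
  obtain ⟨S₂, C₂', h₂, hu₂, ha₂⟩ := hadj u a₁ hua₁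
  obtain ⟨C₂, D₂, a₂, hC₂, hD₂, hne₂, hua₂, ha₂C, hb₂, hlt₂⟩ :=
    hC₁.exists_ncard_sepsBetween_lt h𝒞 hD₁ hne₁ ha₁C hb₁ h₂ hu₂ ha₂
  have hn := hC.not_adj h𝒞 hDS hne.symm haC hbD
  have hn₁ := hC₁.not_adj h𝒞 hD₁ hne₁.symm ha₁C hb₁
  have hn₂ := hC₂.not_adj h𝒞 hD₂ hne₂.symm ha₂C hb₂
  have k₁ := ncard_sepsBetween_le_of_edge_iff hD hhom h𝒞 hua hua₁ hub hn hn₁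
  have k₂ := ncard_sepsBetween_le_of_edge_iff hD hhom h𝒞 hua hua₂ hub hn hn₂
  have k₃ := ncard_sepsBetween_le_of_edge_iff hD hhom h𝒞 hua₁ hua₂ hub hn₁ hn₂
  by_cases e₀ : E u a <;> by_cases e₁ : E u a₁ <;> by_cases e₂ : E u a₂ <;>
    simp only [e₀, e₁, e₂, iff_self, forall_const, iff_true, iff_false,
      not_true_eq_false] at k₁ k₂ k₃ <;> omega

theorem HasTriangle.exists_transitive_pair (h : HasTriangle E) :
    ∃ x y z, E x y ∧ E y z ∧ (UG E).Adj x z := by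
  obtain ⟨x, y, z, hxy, hyz, hxz⟩ := h
  rcases UG.edge_or_of_adj hxy with h1 | h1 <;> rcases UG.edge_or_of_adj hyz with h2 | h2
  · exact ⟨x, y, z, h1, h2, hxz⟩
  · rcases UG.edge_or_of_adj hxz with h3 | h3
    · exact ⟨x, z, y, h3, h2, hxy⟩
    · exact ⟨z, x, y, h3, h1, hyz.symm⟩
  · rcases UG.edge_or_of_adj hxz with h3 | h3
    · exact ⟨y, x, z, h1, h3, hyz⟩
    · exact ⟨y, z, x, h2, h3, hxy.symm⟩
  · exact ⟨z, y, x, h2, h1, hxz.symm⟩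

theorem IsCutComp.exists_in_out (hD : IsDigraph E) (hhom : DigraphCHom E) (htr : HasTriangle E)
    (h𝒞 : IsBasic (UG E) 𝒞) {S C : Set V} (hC : IsCutComp 𝒞 S C) {s : V} (hs : s ∈ S) :
    (∃ x ∈ C, E s x) ∧ ∃ x ∈ C, E x s := by
  obtain ⟨u, v, w, huv, hvw, huw⟩ := htr.exists_transitive_pair
  obtain ⟨a, haC, hsa⟩ := hC.exists_adj h𝒞 hs
  have hmem : ∀ z, (UG E).Adj s z → (UG E).Adj a z → z ∈ C := fun z hsz haz =>
    (hC.closed h𝒞 a haC z haz).resolve_right fun hz =>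
      not_adj_of_mem_separator hD hhom h𝒞 hC hs hz hsz
  rcases UG.edge_or_of_adj hsa with h | h
  · obtain ⟨φ, hφ, rfl, rfl⟩ := hhom.exists_of_edge hD hvw h
    have h1 : E (φ u) (φ v) := (hφ u v).2 huv
    exact ⟨⟨_, haC, h⟩, φ u, hmem _ (UG.adj_of_edge hD h1).symm
      (φ.map_rel_iff.2 huw).symm, h1⟩
  · obtain ⟨φ, hφ, rfl, rfl⟩ := hhom.exists_of_edge hD huv h
    have h1 : E (φ v) (φ w) := (hφ v w).2 hvw
    exact ⟨⟨φ w, hmem _ (UG.adj_of_edge hD h1) (φ.map_rel_iff.2 huw), h1⟩, _, haC, h⟩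

/-- Every edge joins a separator to a component belonging to it, in either direction. -/
theorem exists_isCutComp_of_adj (hD : IsDigraph E) (hconn : (UG E).Connected)
    (hhom : DigraphCHom E) (htr : HasTriangle E) (h𝒞 : IsBasic (UG E) 𝒞) {x y : V}
    (h : (UG E).Adj x y) : ∃ S D, IsCutComp 𝒞 S D ∧ x ∈ D ∧ y ∈ S := by
  obtain ⟨c, hc⟩ := h𝒞.1.1
  have hC : IsCutComp 𝒞 (c.1 ∩ c.2) (c.1 \ c.2) := ⟨c, hc, rfl, rfl⟩
  obtain ⟨K, hK, hne⟩ := hC.exists_ne h𝒞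
  obtain ⟨s, hs⟩ : (c.1 ∩ c.2).Nonempty := by
    obtain ⟨a⟩ := (hC.connected h𝒞).nonempty
    obtain ⟨b⟩ := (hK.connected h𝒞).nonempty
    obtain ⟨w⟩ := hconn.preconnected a.1 b.1
    by_contra hemp
    refine (hC.isMinSep h𝒞 hK hne.symm a.2 b.2).2.2.1 ⟨w, fun v _ hv => hemp ⟨v, hv⟩⟩
  obtain ⟨⟨p, hp, hsp⟩, ⟨q, hq, hqs⟩⟩ := hK.exists_in_out hD hhom htr h𝒞 hs
  rcases UG.edge_or_of_adj h with h | h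
  · obtain ⟨φ, -, rfl, rfl⟩ := hhom.exists_of_edge hD hqs h
    exact ⟨_, _, hK.image h𝒞 φ, ⟨q, hq, rfl⟩, ⟨s, hs, rfl⟩⟩
  · obtain ⟨φ, -, rfl, rfl⟩ := hhom.exists_of_edge hD hsp h
    exact ⟨_, _, hK.image h𝒞 φ, ⟨p, hp, rfl⟩, ⟨s, hs, rfl⟩⟩

open scoped Classical in
/-- Every orientation pattern is realized by an induced path whose end vertices are separated. -/
theorem exists_separated_path (hD : IsDigraph E) (hconn : (UG E).Connected)
    (hhom : DigraphCHom E) (htr : HasTriangle E) (h𝒞 : IsBasic (UG E) 𝒞) (d : ℕ → Prop) (m : ℕ) :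
    ∃ q : ℕ → V, (∀ i < m + 1, if d i then E (q i) (q (i + 1)) else E (q (i + 1)) (q i)) ∧
      (∀ j ≤ m + 1, ∀ i, i + 1 < j → q i ≠ q j ∧ ¬ (UG E).Adj (q i) (q j)) ∧
      (1 ≤ m → ∃ S C D, IsCutComp 𝒞 S C ∧ IsCutComp 𝒞 S D ∧ C ≠ D ∧ q 0 ∈ D ∧ q (m + 1) ∈ C) ∧
      ∃ S D, IsCutComp 𝒞 S D ∧ q (m + 1) ∈ S ∧ ∀ i ≤ m, q i ∈ D := by
  induction m with
  | zero =>
    obtain ⟨x, y, -, hxy, -⟩ := htr.exists_transitive_pair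
    have hadj := UG.adj_of_edge hD hxy
    by_cases hd : d 0
    · obtain ⟨S, D, hS, hx, hy⟩ := exists_isCutComp_of_adj hD hconn hhom htr h𝒞 hadj
      refine ⟨fun n => if n = 0 then x else y, ?_, fun j hj i hi => by omega, by omega,
        S, D, hS, by simpa using hy, ?_⟩
      · intro i hi
        obtain rfl : i = 0 := by omega
        simpa [hd] using hxy
      · intro i hi
        obtain rfl : i = 0 := by omega
        simpa using hx
    · obtain ⟨S, D, hS, hy, hx⟩ := exists_isCutComp_of_adj hD hconn hhom htr h𝒞 hadj.symm
      refine ⟨fun n => if n = 0 then y else x, ?_, fun j hj i hi => by omega, by omega,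
        S, D, hS, by simpa using hx, ?_⟩
      · intro i hi
        obtain rfl : i = 0 := by omega
        simpa [hd] using hxy
      · intro i hi
        obtain rfl : i = 0 := by omega
        simpa using hy
  | succ m ih =>
    obtain ⟨q, hq, hind, -, S, D, hS, hqS, hqD⟩ := ih
    obtain ⟨C, hC, hne⟩ := hS.exists_ne h𝒞
    obtain ⟨z, hzC, hz⟩ : ∃ z ∈ C, if d (m + 1) then E (q (m + 1)) z else E z (q (m + 1)) := by
      obtain ⟨h1, h2⟩ := hC.exists_in_out hD hhom htr h𝒞 hqS
      by_cases hd : d (m + 1)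
      · simpa [hd] using h1
      · simpa [hd] using h2
    have hadj : (UG E).Adj (q (m + 1)) z := by
      split_ifs at hz
      · exact UG.adj_of_edge hD hz
      · exact (UG.adj_of_edge hD hz).symm
    obtain ⟨S', D', hS', hqD', hzS'⟩ := exists_isCutComp_of_adj hD hconn hhom htr h𝒞 hadj
    have hsub := hC.subset_union_of_mem h𝒞 hS' hzS' hzC
    have hDD' := hC.subset_of_subset_union h𝒞 hS hne.symm hsub hS' hqS hqD'
    have hlast : Function.update q (m + 2) z (m + 2) = z := Function.update_self _ _ _
    have hold : ∀ i ≤ m + 1, Function.update q (m + 2) z i = q i := fun i hi =>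
      Function.update_of_ne (by omega) _ _
    refine ⟨Function.update q (m + 2) z, ?_, ?_, fun _ => ⟨S, C, D, hC, hS, hne, ?_, ?_⟩,
      S', D', hS', ?_, ?_⟩
    · intro i hi
      rcases Nat.lt_succ_iff_lt_or_eq.1 hi with hi | rfl
      · rw [hold i (by omega), hold (i + 1) (by omega)]
        exact hq i hi
      · rw [hold (m + 1) le_rfl, hlast]
        exact hz
    · intro j hj i hi
      rcases Nat.le_succ_iff.1 hj with hj | rfl
      · rw [hold i (by omega), hold j hj]
        exact hind j hj i hi
      · rw [hold i (by omega), hlast]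
        exact hS.not_adj h𝒞 hC hne.symm (hqD i (by omega)) hzC
    · rw [hold 0 (by omega)]
      exact hqD 0 (by omega)
    · rw [hlast]
      exact hzC
    · rw [hlast]
      exact hzS'
    · intro i hi
      rw [hold i hi]
      rcases Nat.le_succ_iff.1 hi with hi | rfl
      · exact hDD' (hqD i hi)
      · exact hqD'

end Digraph

section Geodesic

variable {V : Type u} {G : SimpleGraph V}

theorem SimpleGraph.Walk.dist_getVert_of_length_eq_dist (hG : G.Connected) {u v : V}
    (w : G.Walk u v) (hw : w.length = G.dist u v) {i : ℕ} (hi : i ≤ w.length) :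
    G.dist u (w.getVert i) = i := by
  have h1 := SimpleGraph.dist_le (w.take i)
  have h2 := SimpleGraph.dist_le (w.drop i)
  have h3 := hG.dist_triangle (u := u) (v := w.getVert i) (w := v)
  rw [SimpleGraph.Walk.take_length] at h1
  rw [SimpleGraph.Walk.drop_length] at h2
  omega

end Geodesic

/-- Any two nonadjacent vertices lie in distinct components belonging to one separator. -/
theorem exists_separating_of_not_adj {V : Type u} {E : V → V → Prop} (hD : IsDigraph E)
    (hconn : (UG E).Connected) (hhom : DigraphCHom E) (htr : HasTriangle E)
    {𝒞 : Set (Set V × Set V)} (h𝒞 : IsBasic (UG E) 𝒞) {x y : V} (hne : x ≠ y)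
    (hxy : ¬ (UG E).Adj x y) :
    ∃ S C D, IsCutComp 𝒞 S C ∧ IsCutComp 𝒞 S D ∧ C ≠ D ∧ x ∈ D ∧ y ∈ C := by
  obtain ⟨w, hw⟩ := hconn.exists_walk_length_eq_dist x y
  have hdist := fun {i} hi => w.dist_getVert_of_length_eq_dist hconn hw (i := i) hi
  obtain ⟨m, hm⟩ : ∃ m, w.length = m + 2 := by
    have h0 : w.length ≠ 0 := fun h => hne (SimpleGraph.Walk.eq_of_length_eq_zero h)
    have h1 : w.length ≠ 1 := fun h => hxy (SimpleGraph.Walk.adj_of_length_eq_one h)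
    exact ⟨w.length - 2, by omega⟩
  set p := w.getVert with hp
  have hp0 : p 0 = x := w.getVert_zero
  have hpm : p (m + 2) = y := hm ▸ w.getVert_length
  have hpadj : ∀ i < m + 2, (UG E).Adj (p i) (p (i + 1)) := fun i hi =>
    w.adj_getVert_succ (by omega)
  have hpinj : Set.InjOn p (Set.Iic (m + 2)) := fun i hi j hj hij => by
    have hi : i ≤ m + 2 := hi
    have hj : j ≤ m + 2 := hj
    rw [← hdist (i := i) (by omega), ← hdist (i := j) (by omega), hij]
  have hpind : ∀ j ≤ m + 2, ∀ i, i + 1 < j → ¬ (UG E).Adj (p i) (p j) := by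
    intro j hj i hi hadj
    have h1 := hdist (i := i) (by omega)
    have h2 := hdist (i := j) (by omega)
    have h3 := hconn.dist_triangle (u := x) (v := p i) (w := p j)
    rw [SimpleGraph.dist_eq_one_iff_adj.2 hadj] at h3
    omega
  obtain ⟨q, hq, hqind, hsep, -⟩ := exists_separated_path hD hconn hhom htr h𝒞
    (fun i => E (p i) (p (i + 1))) (m + 1)
  obtain ⟨S, C, D, hC, hDS, hCD, h0, h1⟩ := hsep (by omega)
  have hqadj : ∀ i < m + 2, (UG E).Adj (q i) (q (i + 1)) := by
    intro i hi
    have := hq i hi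
    split_ifs at this
    · exact UG.adj_of_edge hD this
    · exact (UG.adj_of_edge hD this).symm
  have hqne : ∀ j ≤ m + 2, ∀ i < j, q i ≠ q j := by
    intro j hj i hi
    rcases Nat.lt_or_ge (i + 1) j with h | h
    · exact (hqind j hj i h).1
    · obtain rfl : j = i + 1 := by omega
      exact (hqadj i (by omega)).ne
  have hqinj : Set.InjOn q (Set.Iic (m + 2)) := fun i hi j hj hij => by
    rcases lt_trichotomy i j with h | h | h
    · exact absurd hij (hqne j hj i h)
    · exact h
    · exact absurd hij.symm (hqne i hi j h)
  have hstep : ∀ i < m + 2, (E (q i) (q (i + 1)) ↔ E (p i) (p (i + 1))) ∧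
      (E (q (i + 1)) (q i) ↔ E (p (i + 1)) (p i)) := by
    intro i hi
    have h1 := hq i hi
    by_cases h : E (p i) (p (i + 1))
    · simp only [h, if_true] at h1
      exact ⟨iff_of_true h1 h, iff_of_false (hD.2 _ _ h1) (hD.2 _ _ h)⟩
    · simp only [h, if_false] at h1
      exact ⟨iff_of_false (hD.2 _ _ h1) h,
        iff_of_true h1 ((UG.edge_or_of_adj (hpadj i hi)).resolve_left h)⟩
  have hlt : ∀ j ≤ m + 2, ∀ i < j, (E (q i) (q j) ↔ E (p i) (p j)) ∧
      (E (q j) (q i) ↔ E (p j) (p i)) := by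
    intro j hj i hi
    rcases Nat.lt_or_ge (i + 1) j with h | h
    · have h1 := (hqind j hj i h).2
      have h2 := hpind j hj i h
      exact ⟨iff_of_false (fun e => h1 (UG.adj_of_edge hD e))
          fun e => h2 (UG.adj_of_edge hD e),
        iff_of_false (fun e => h1 (UG.adj_of_edge hD e).symm)
          fun e => h2 (UG.adj_of_edge hD e).symm⟩
    · obtain rfl : j = i + 1 := by omega
      exact hstep i (by omega)
  obtain ⟨φ, -, hφ⟩ := hhom.exists_of_path (m + 2) q p hqinj hpinj
    (fun i hi j hj => by
      rcases lt_trichotomy i j with h | rfl | h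
      · exact (hlt j hj i h).1
      · exact iff_of_false (hD.1 _) (hD.1 _)
      · exact (hlt i hi j h).2) hqadj
  refine ⟨_, _, _, hC.image h𝒞 φ, hDS.image h𝒞 φ, ?_, ⟨q 0, h0, ?_⟩, ⟨q (m + 2), h1, ?_⟩⟩
  · exact fun h => hCD (Set.image_injective.2 φ.injective h)
  · rw [hφ 0 (by omega), hp0]
  · rw [hφ (m + 2) le_rfl, hpm]

/-- In a connected C-homogeneous digraph with more than one end that contains a
triangle, every block of a basic cut system that contains an edge is complete. -/
theorem stmt_7 {V : Type u} (E : V → V → Prop) (hD : IsDigraph E)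
    (hconn : (UG E).Connected) (hhom : DigraphCHom E) (htr : HasTriangle E)
    (hends : MoreThanOneEnd (UG E))
    (𝒞 : Set (Set V × Set V)) (h𝒞 : IsBasic (UG E) 𝒞) :
    ∀ X : Set V, IsCBlock 𝒞 X → (∃ x ∈ X, ∃ y ∈ X, (UG E).Adj x y) →
      ∀ x ∈ X, ∀ y ∈ X, x ≠ y → (UG E).Adj x y := by
  intro X hX _ x hx y hy hne
  by_contra hxy
  obtain ⟨S, C, D, hC, hDS, hCD, hxD, hyC⟩ :=
    exists_separating_of_not_adj hD hconn hhom htr h𝒞 hne hxy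
  exact hX.1.not_separated h𝒞 hC hDS hCD hy hx hyC hxD
end
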